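/- arXiv:1907.09599 — 6 statements merged into one kernel-verified Lean document; each statement's English description precedes it below -/
import Mathlib

section
/- For every linear operator T in H, the essential numerical range W_e(T) is a closed convex subset of ℂ, and the convex hull of the essential spectrum is contained in it: conv σ_e(T) ⊆ W_e(T). -/
open Filter Topology

noncomputable section

variable {H : Type*} [NormedAddCommGroup H] [InnerProductSpace ℂ H] [CompleteSpace H]

/-- A sequence in an inner product space converges weakly to zero. -/
def WeakNull {E : Type*} [NormedAddCommGroup E] [InnerProductSpace ℂ E] (x : ℕ → E) : Prop :=
  ∀ y : E, Tendsto (fun n => (inner ℂ (x n) y : ℂ)) atTop (nhds 0)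

/-- The numerical range of a (possibly unbounded) linear operator `T` in `H`,
`W(T) = {⟨Tx, x⟩ : x ∈ dom T, ‖x‖ = 1}`. -/
def numRange (T : H →ₗ.[ℂ] H) : Set ℂ :=
  {z | ∃ x : T.domain, ‖(x : H)‖ = 1 ∧ (inner ℂ ((x : H)) (T x) : ℂ) = z}

/-- The essential numerical range of a (possibly unbounded) linear operator `T` in `H`. -/
def essNumRange (T : H →ₗ.[ℂ] H) : Set ℂ :=
  {z | ∃ x : ℕ → T.domain, (∀ n, ‖((x n : H))‖ = 1) ∧
    WeakNull (fun n => ((x n : H))) ∧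
    Tendsto (fun n => (inner ℂ ((x n : H)) (T (x n)) : ℂ)) atTop (nhds z)}

/-- The essential spectrum `σ_e(T)` (the version `σ_{e2}` via singular Weyl sequences). -/
def essSpec (T : H →ₗ.[ℂ] H) : Set ℂ :=
  {z | ∃ x : ℕ → T.domain, (∀ n, ‖((x n : H))‖ = 1) ∧
    WeakNull (fun n => ((x n : H))) ∧
    Tendsto (fun n => ‖T (x n) - z • ((x n : H))‖) atTop (nhds 0)}


open ComplexConjugate in
theorem hausdorff_scalar (l m A B g : ℂ) (hg : ‖g‖ ≤ 1 / 2) (t : ℝ) (ht0 : 0 ≤ t) (ht1 : t ≤ 1) :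
    ∃ a b : ℂ, ‖a‖ ≤ 2 ∧ ‖b‖ ≤ 2 ∧
      conj a * a + conj b * b + conj a * b * g + conj b * a * conj g = 1 ∧
      conj a * a * l + conj b * b * m + conj a * b * A + conj b * a * B
        = t * l + (1 - t) * m := by
  by_cases hlm : l = m
  · subst hlm
    exact ⟨1, 0, by simp, by simp, by simp, by simp; ring⟩
  set d : ℂ := l - m with hd
  have hd0 : d ≠ 0 := sub_ne_zero.mpr hlm
  set D : ℂ := conj d * (A - m * g) - conj (conj d * (B - m * conj g)) with hD
  obtain ⟨c, hc1, hcD⟩ : ∃ c : ℂ, conj c * c = 1 ∧ (c * D).im = 0 := by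
    by_cases h0 : D = 0
    · exact ⟨1, by simp, by simp [h0]⟩
    · have hn : (‖D‖ : ℂ) ≠ 0 := by simpa using h0
      refine ⟨conj D / ‖D‖, ?_, ?_⟩
      · have : D * conj D = (‖D‖ : ℂ) ^ 2 := by rw [Complex.mul_conj']
        simp only [map_div₀, Complex.conj_conj, Complex.conj_ofReal]
        field_simp
        exact this
      · have : D * conj D = (‖D‖ : ℂ) ^ 2 := by rw [Complex.mul_conj']
        have h2 : conj D / ‖D‖ * D = ((‖D‖ : ℝ) : ℂ) := by
          field_simp
          rw [mul_comm]; exact this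
        rw [h2]; simp
  -- key quantities
  let N : ℝ → ℝ := fun s => s ^ 2 + (1 - s) ^ 2 + 2 * (s * (1 - s)) * (c * g).re
  let K : ℂ := conj d * (c * (A - m * g) + conj c * (B - m * conj g))
  have hK : K.im = 0 := by
    have : K = c * D + (conj (c * (conj (conj d * (B - m * conj g))))
        + c * (conj (conj d * (B - m * conj g)))) := by
      simp only [K, hD, map_mul, map_sub, Complex.conj_conj]; ring
    rw [this, Complex.add_im, hcD]
    simp only [Complex.add_im, Complex.conj_im]
    ring
  let n2 : ℝ := Complex.normSq d
  let h : ℝ → ℝ := fun s => s ^ 2 * n2 + s * (1 - s) * K.re - t * n2 * N s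
  have hn2 : 0 ≤ n2 := Complex.normSq_nonneg d
  have hcont : ContinuousOn h (Set.Icc 0 1) := by
    apply Continuous.continuousOn
    simp only [h, N]; fun_prop
  have h0 : h 0 ≤ 0 := by simp [h, N]; positivity
  have h1 : 0 ≤ h 1 := by simp [h, N]; nlinarith
  obtain ⟨s, hs, hs0⟩ := intermediate_value_Icc (zero_le_one' ℝ) hcont ⟨h0, h1⟩
  have hcn : ‖c‖ = 1 := by
    have h3 : ‖conj c * c‖ = 1 := by rw [hc1]; simp
    rw [norm_mul, RCLike.norm_conj] at h3
    nlinarith [norm_nonneg c]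
  have hre : |(c * g).re| ≤ 1 / 2 := by
    refine (Complex.abs_re_le_norm _).trans ?_
    rw [norm_mul, hcn, one_mul]; exact hg
  obtain ⟨hr1, hr2⟩ := abs_le.mp hre
  obtain ⟨hsa, hsb⟩ := hs
  have hss : 0 ≤ s * (1 - s) := mul_nonneg hsa (by linarith)
  have hN : 1 / 4 ≤ N s := by
    simp only [N]; nlinarith [sq_nonneg (s - 1 / 2)]
  let r : ℝ := (Real.sqrt (N s))⁻¹
  have hr0 : 0 ≤ r := by positivity
  have hr : r ^ 2 * N s = 1 := by
    simp only [r]; rw [inv_pow, Real.sq_sqrt (by linarith)]; field_simp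
  have hr2' : r ≤ 2 := by nlinarith
  have hrC : (r : ℂ) ^ 2 * (N s : ℂ) = 1 := by exact_mod_cast hr
  have hNC : (N s : ℂ) = (s : ℂ) ^ 2 + (1 - s) ^ 2 + s * (1 - s) * (c * g + conj c * conj g) := by
    rw [← map_mul, Complex.add_conj]
    simp only [N]; push_cast; ring
  have hKC : K = (K.re : ℂ) := Complex.ext (by simp) (by simp [hK])
  have hnC : (n2 : ℂ) = conj d * d := Complex.normSq_eq_conj_mul_self
  have hsC : (s : ℂ) ^ 2 * (conj d * d) + s * (1 - s) * K - t * (conj d * d) * N s = 0 := by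
    rw [← hnC, hKC]; exact_mod_cast hs0
  have hmain : (s : ℂ) ^ 2 * d + s * (1 - s) * (c * (A - m * g) + conj c * (B - m * conj g))
      - t * d * N s = 0 := by
    have hcd : conj d ≠ 0 := by simpa using hd0
    apply mul_left_cancel₀ hcd
    rw [mul_zero, ← hsC]; simp only [K]; ring
  refine ⟨r * s, r * (1 - s) * c, ?_, ?_, ?_, ?_⟩
  · rw [norm_mul, Complex.norm_real, Complex.norm_real, Real.norm_of_nonneg hr0,
      Real.norm_of_nonneg hsa]
    nlinarith
  · have : (1 - s : ℂ) = ((1 - s : ℝ) : ℂ) := by push_cast; ring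
    rw [this, norm_mul, norm_mul, Complex.norm_real, Complex.norm_real, Real.norm_of_nonneg hr0,
      Real.norm_of_nonneg (by linarith : 0 ≤ 1 - s), hcn]
    nlinarith
  · simp only [map_mul, map_sub, map_one, Complex.conj_ofReal]
    linear_combination (r : ℂ) ^ 2 * (1 - s) ^ 2 * hc1 + hrC - (r : ℂ) ^ 2 * hNC
  · simp only [map_mul, map_sub, map_one, Complex.conj_ofReal]
    have e1 : (r : ℂ) ^ 2 * (s ^ 2 * l + (1 - s) ^ 2 * m + s * (1 - s) * (c * A + conj c * B))
        = (t * l + (1 - t) * m) * (r ^ 2 * N s) := by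
      have : (s : ℂ) ^ 2 * l + (1 - s) ^ 2 * m + s * (1 - s) * (c * A + conj c * B)
        = (t * l + (1 - t) * m) * N s := by
        rw [hd] at hmain
        linear_combination hmain - m * hNC
      rw [this]; ring
    rw [hrC, mul_one] at e1
    rw [← e1]
    linear_combination (r : ℂ) ^ 2 * (1 - s) ^ 2 * m * hc1

theorem essNumRange_convex_aux (T : H →ₗ.[ℂ] H) : Convex ℝ (essNumRange T) := by
  rintro l ⟨x, hx1, hx0, hxl⟩ m ⟨y, hy1, hy0, hym⟩ t u ht hu htu
  have hk : ∀ n : ℕ, ∃ k : ℕ, n ≤ k ∧ ‖(inner ℂ (x n : H) (y k : H) : ℂ)‖ ≤ 1 / 2 := by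
    intro n
    have h1 := (hy0 (x n : H)).norm
    rw [norm_zero] at h1
    obtain ⟨k, hk1, hk2⟩ :=
      ((eventually_ge_atTop n).and (h1.eventually_le_const (by norm_num : (0 : ℝ) < 1 / 2))).exists
    exact ⟨k, hk1, by rw [← inner_conj_symm, RCLike.norm_conj]; exact hk2⟩
  choose k hkn hk using hk
  have hkt : Tendsto k atTop atTop := tendsto_atTop_mono hkn tendsto_id
  have hu' : u = 1 - t := by linarith
  have hab := fun n => hausdorff_scalar (inner ℂ (x n : H) (T (x n)))
    (inner ℂ (y (k n) : H) (T (y (k n)))) (inner ℂ (x n : H) (T (y (k n))))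
    (inner ℂ (y (k n) : H) (T (x n))) (inner ℂ (x n : H) (y (k n) : H)) (hk n) t ht (by linarith)
  choose a b ha hb hnorm hq using hab
  refine ⟨fun n => a n • x n + b n • y (k n), ?_, ?_, ?_⟩
  · intro n
    have h1 : (inner ℂ (((a n • x n + b n • y (k n) : T.domain)) : H)
        (((a n • x n + b n • y (k n) : T.domain)) : H) : ℂ) = 1 := by
      rw [← hnorm n, inner_conj_symm]
      have e1 : (inner ℂ (x n : H) (x n : H) : ℂ) = 1 := by
        rw [inner_self_eq_norm_sq_to_K, hx1]; simp
      have e2 : (inner ℂ (y (k n) : H) (y (k n) : H) : ℂ) = 1 := by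
        rw [inner_self_eq_norm_sq_to_K, hy1]; simp
      simp only [Submodule.coe_add, Submodule.coe_smul, inner_add_left, inner_add_right,
        inner_smul_left, inner_smul_right, e1, e2]
      ring
    have h2 : ‖(((a n • x n + b n • y (k n) : T.domain)) : H)‖ ^ 2 = 1 := by
      rw [← inner_self_eq_norm_sq (𝕜 := ℂ), h1]; simp
    nlinarith [norm_nonneg (((a n • x n + b n • y (k n) : T.domain)) : H)]
  · intro z
    have h1 := (hx0 z).norm
    have h2 := ((hy0 z).comp hkt).norm
    rw [norm_zero] at h1 h2
    have h3 := (h1.const_mul 2).add (h2.const_mul 2)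
    simp only [mul_zero, add_zero] at h3
    refine squeeze_zero_norm (fun n => ?_) h3
    simp only [Submodule.coe_add, Submodule.coe_smul, inner_add_left, inner_smul_left,
      Function.comp]
    refine (norm_add_le _ _).trans ?_
    rw [norm_mul, norm_mul, RCLike.norm_conj, RCLike.norm_conj]
    gcongr
    · exact ha n
    · exact hb n
  · have h3 := (hxl.const_mul (t : ℂ)).add ((hym.comp hkt).const_mul (1 - t : ℂ))
    have e : t • l + u • m = t * l + (1 - t) * m := by
      rw [hu']; simp
    rw [e]
    refine h3.congr (fun n => ?_)
    simp only [Function.comp]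
    rw [← hq n]
    simp only [LinearPMap.map_add, LinearPMap.map_smul, Submodule.coe_add, Submodule.coe_smul,
      inner_add_left, inner_add_right, inner_smul_left, inner_smul_right]
    ring

theorem essNumRange_closed_aux [TopologicalSpace.SeparableSpace H] (T : H →ₗ.[ℂ] H) :
    IsClosed (essNumRange T) := by
  rw [← closure_subset_iff_isClosed]
  intro z hz
  let e : ℕ → H := TopologicalSpace.denseSeq H
  have he : DenseRange e := TopologicalSpace.denseRange_denseSeq H
  have key : ∀ n : ℕ, ∃ v : T.domain, ‖(v : H)‖ = 1 ∧
      (∀ j ≤ n, ‖(inner ℂ (v : H) (e j) : ℂ)‖ ≤ 1 / ((n : ℝ) + 1)) ∧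
      dist (inner ℂ (v : H) (T v) : ℂ) z ≤ 2 * (1 / ((n : ℝ) + 1)) := by
    intro n
    have hpos : (0 : ℝ) < 1 / ((n : ℝ) + 1) := by positivity
    obtain ⟨w, ⟨x, hx1, hx0, hxw⟩, hw⟩ := Metric.mem_closure_iff.mp hz _ hpos
    have h1 : ∀ᶠ k in atTop, ∀ j ∈ Set.Iic n,
        ‖(inner ℂ (x k : H) (e j) : ℂ)‖ ≤ 1 / ((n : ℝ) + 1) := by
      rw [Filter.eventually_all_finite (Set.finite_Iic n)]
      intro j _
      have h2 := (hx0 (e j)).norm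
      rw [norm_zero] at h2
      exact h2.eventually_le_const hpos
    have h3 := Metric.tendsto_nhds.mp hxw _ hpos
    obtain ⟨k, hk1, hk2⟩ := (h1.and h3).exists
    refine ⟨x k, hx1 k, fun j hj => hk1 j hj, ?_⟩
    refine (dist_triangle _ w _).trans ?_
    rw [dist_comm w z]; linarith
  choose v hv1 hv2 hv3 using key
  have hlim : Tendsto (fun n : ℕ => 1 / ((n : ℝ) + 1)) atTop (nhds 0) :=
    tendsto_one_div_add_atTop_nhds_zero_nat
  refine ⟨v, hv1, ?_, ?_⟩
  · intro y
    rw [Metric.tendsto_nhds]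
    intro ε hε
    obtain ⟨j, hj⟩ := he.exists_dist_lt y (half_pos hε)
    filter_upwards [eventually_ge_atTop j, hlim.eventually_lt_const (half_pos hε)] with n hn1 hn2
    rw [dist_zero_right]
    have e1 : (inner ℂ (v n : H) y : ℂ) = inner ℂ (v n : H) (e j) + inner ℂ (v n : H) (y - e j) := by
      rw [← inner_add_right]; congr 1; abel
    have e2 := norm_inner_le_norm (𝕜 := ℂ) (v n : H) (y - e j)
    rw [hv1, one_mul, ← dist_eq_norm] at e2
    rw [e1]
    have := norm_add_le (inner ℂ (v n : H) (e j) : ℂ) (inner ℂ (v n : H) (y - e j))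
    have := hv2 n j hn1
    linarith
  · rw [tendsto_iff_dist_tendsto_zero]
    have := hlim.const_mul 2
    rw [mul_zero] at this
    exact squeeze_zero (fun _ => dist_nonneg) hv3 this

theorem essSpec_subset_aux (T : H →ₗ.[ℂ] H) : essSpec T ⊆ essNumRange T := by
  rintro z ⟨x, hx1, hx0, hxz⟩
  refine ⟨x, hx1, hx0, ?_⟩
  rw [tendsto_iff_norm_sub_tendsto_zero]
  refine squeeze_zero (fun _ => norm_nonneg _) (fun n => ?_) hxz
  have e1 : (inner ℂ (x n : H) (x n : H) : ℂ) = 1 := by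
    rw [inner_self_eq_norm_sq_to_K, hx1]; simp
  have e2 := norm_inner_le_norm (𝕜 := ℂ) (x n : H) (T (x n) - z • (x n : H))
  rw [inner_sub_right, inner_smul_right, e1, mul_one, hx1, one_mul] at e2
  exact e2

/-- Prop. 2.2: the essential numerical range is closed and convex, and contains the
convex hull of the essential spectrum. -/
theorem essNumRange_isClosed_convex_convexHull_essSpec_subset
    [TopologicalSpace.SeparableSpace H] (hinf : ¬FiniteDimensional ℂ H)
    (T : H →ₗ.[ℂ] H) :
    IsClosed (essNumRange T) ∧ Convex ℝ (essNumRange T) ∧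
      convexHull ℝ (essSpec T) ⊆ essNumRange T := by
  exact ⟨essNumRange_closed_aux T, essNumRange_convex_aux T,
    convexHull_min (essSpec_subset_aux T) (essNumRange_convex_aux T)⟩
end
end

section
/- Let T be a linear operator in H. Suppose that either W(T) = ℂ, or the closure of W(T) is a (possibly degenerate) closed strip, i.e. there exist θ ∈ ℝ and real numbers α ≤ β such that the closure of W(T) equals {z ∈ ℂ : α ≤ Re(e^{iθ} z) ≤ β} (the case α = β being a line). Then W_e(T) ≠ ∅. In particular, if T is densely defined and not closable, then W_e(T) ≠ ∅. -/
open Filter Topology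

noncomputable section

variable {H : Type*} [NormedAddCommGroup H] [InnerProductSpace ℂ H] [CompleteSpace H]

/-- `T` is closable: if `x_n ∈ dom T`, `x_n → 0` and `T x_n → y`, then `y = 0`. -/
def IsClosableSeq (T : H →ₗ.[ℂ] H) : Prop :=
  ∀ (x : ℕ → T.domain) (y : H),
    Tendsto (fun n => ((x n : H))) atTop (nhds 0) →
    Tendsto (fun n => T (x n)) atTop (nhds y) → y = 0


/-- auxiliary: the quadratic form of `T` -/
def qf (T : H →ₗ.[ℂ] H) (x : T.domain) : ℂ := inner ℂ (x : H) (T x)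

theorem qf_add_smul (T : H →ₗ.[ℂ] H) (y x : T.domain) (s : ℂ) :
    qf T (y + s • x) = qf T y + s * inner ℂ (y : H) (T x)
      + (starRingEnd ℂ) s * inner ℂ (x : H) (T y) + (starRingEnd ℂ) s * s * qf T x := by
  simp only [qf, LinearPMap.map_add, LinearPMap.map_smul, Submodule.coe_add, Submodule.coe_smul,
    inner_add_left, inner_add_right, inner_smul_left, inner_smul_right]
  ring

theorem qf_smul (T : H →ₗ.[ℂ] H) (x : T.domain) (s : ℂ) :
    qf T (s • x) = (starRingEnd ℂ) s * s * qf T x := by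
  simp only [qf, LinearPMap.map_smul, Submodule.coe_smul,
    inner_smul_left, inner_smul_right]
  ring

theorem qf_smul_real (T : H →ₗ.[ℂ] H) (x : T.domain) (s : ℝ) :
    qf T ((s : ℂ) • x) = ((s ^ 2 : ℝ) : ℂ) * qf T x := by
  rw [qf_smul, Complex.conj_ofReal]; push_cast; ring

theorem root_aux (b r : ℝ) : ∃ t : ℝ, |t| ≤ 1 ∧ b + r * t - b * t ^ 2 = 0 := by
  have hc : Continuous fun t : ℝ => b + r * t - b * t ^ 2 := by fun_prop
  have h : (0 : ℝ) ∈ Set.uIcc (b + r * (-1) - b * (-1) ^ 2) (b + r * 1 - b * 1 ^ 2) := by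
    rw [Set.mem_uIcc]
    rcases le_total r 0 with h | h
    · right; constructor <;> linarith
    · left; constructor <;> linarith
  obtain ⟨t, ht, h0⟩ := intermediate_value_uIcc (a := (-1 : ℝ)) (b := 1) hc.continuousOn h
  rw [Set.uIcc_of_le (by norm_num)] at ht
  exact ⟨t, abs_le.2 ht, h0⟩

theorem phase_aux (c d : ℂ) : ∃ w : ℂ, ‖w‖ = 1 ∧ (w * c + (starRingEnd ℂ) w * d).im = 0 := by
  by_cases h : c - (starRingEnd ℂ) d = 0
  · refine ⟨1, by simp, ?_⟩
    have h2 : c = (starRingEnd ℂ) d := sub_eq_zero.1 h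
    simp [h2]
  · set v := c - (starRingEnd ℂ) d with hv
    have hn : (‖v‖ : ℝ) ≠ 0 := norm_ne_zero_iff.2 h
    refine ⟨(starRingEnd ℂ) v / (‖v‖ : ℂ), ?_, ?_⟩
    · simp [hn]
    · have e1 : ((starRingEnd ℂ) v / (‖v‖ : ℂ)) = ((‖v‖⁻¹ : ℝ) : ℂ) * (starRingEnd ℂ) v := by
        push_cast; field_simp
      rw [e1]
      simp only [hv, map_mul, map_sub, Complex.conj_conj, Complex.conj_ofReal, Complex.add_im,
        Complex.mul_im, Complex.mul_re, Complex.sub_re, Complex.sub_im, Complex.conj_re,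
        Complex.conj_im, Complex.ofReal_re, Complex.ofReal_im]
      ring

/-- Orthonormal sequences are weakly null. -/
theorem weakNull_orthonormal {E : Type*} [NormedAddCommGroup E] [InnerProductSpace ℂ E]
    {v : ℕ → E} (hv : Orthonormal ℂ v) : WeakNull v := by
  intro y
  have h := (hv.inner_products_summable (x := y)).tendsto_atTop_zero
  rw [tendsto_zero_iff_norm_tendsto_zero]
  have h2 := h.sqrt
  simpa [Real.sqrt_sq] using h2

theorem exists_orthonormal_nat {E : Type*} [NormedAddCommGroup E] [InnerProductSpace ℂ E]
    (h : ¬ FiniteDimensional ℂ E) : ∃ v : ℕ → E, Orthonormal ℂ v := by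
  have h1 : Cardinal.aleph0 ≤ Module.rank ℂ E := by
    by_contra h2
    exact h (Module.rank_lt_aleph0_iff.1 (not_le.1 h2))
  obtain ⟨s, hs⟩ := (le_rank_iff_exists_linearIndependent (K := ℂ) (V := E)).1 h1
  obtain ⟨hs, hli⟩ := hs
  have hinf : Infinite s := Cardinal.infinite_iff.2 hs.ge
  have hli2 : LinearIndependent ℂ (fun n : ℕ => ((Infinite.natEmbedding s n : s) : E)) :=
    LinearIndependent.comp hli (Infinite.natEmbedding s) (Infinite.natEmbedding s).injective
  exact ⟨_, InnerProductSpace.gramSchmidtNormed_orthonormal hli2⟩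

theorem essNumRange_nonempty_of_approx (T : H →ₗ.[ℂ] H)
    (hD : ¬ FiniteDimensional ℂ T.domain) (C : ℝ)
    (hP : ∀ y : T.domain, ‖(y : H)‖ = 1 → ∀ ε : ℝ, 0 < ε →
      ∃ z : T.domain, ‖(z : H) - y‖ < ε ∧ ‖qf T z‖ ≤ C) : (essNumRange T).Nonempty := by
  obtain ⟨v, hv⟩ := exists_orthonormal_nat hD
  have hv' : Orthonormal ℂ (fun n => (v n : H)) :=
    hv.comp_linearIsometry T.domain.subtypeₗᵢ
  have hw := weakNull_orthonormal hv'
  have hz : ∀ n : ℕ, ∃ z : T.domain, ‖(z : H) - v n‖ < (1 / 2) / ((n : ℝ) + 1) ∧ ‖qf T z‖ ≤ C :=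
    fun n => hP (v n) (hv'.1 n) _ (by positivity)
  choose z hz1 hz2 using hz
  have hC : 0 ≤ C := (norm_nonneg _).trans (hz2 0)
  have hhalf : ∀ n, 1 / 2 ≤ ‖(z n : H)‖ := by
    intro n
    have h1 : (1 / 2 : ℝ) / ((n : ℝ) + 1) ≤ 1 / 2 := by
      apply div_le_self (by norm_num); linarith [(Nat.cast_nonneg n : (0 : ℝ) ≤ n)]
    have h2 := norm_sub_norm_le (v n : H) (z n : H)
    rw [norm_sub_rev, hv'.1 n] at h2
    linarith [hz1 n]
  have hpos : ∀ n, 0 < ‖(z n : H)‖ := fun n => by linarith [hhalf n]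
  -- weak nullity of z
  have hd : Tendsto (fun n => (z n : H) - v n) atTop (𝓝 0) := by
    rw [tendsto_zero_iff_norm_tendsto_zero]
    have : Tendsto (fun n : ℕ => (1 / 2 : ℝ) / ((n : ℝ) + 1)) atTop (𝓝 0) :=
      tendsto_const_nhds.div_atTop (tendsto_atTop_add_const_right _ _ tendsto_natCast_atTop_atTop)
    exact squeeze_zero (fun _ => norm_nonneg _) (fun n => (hz1 n).le) this
  have hwz : WeakNull (fun n => (z n : H)) := by
    intro y
    have h1 : Tendsto (fun n => inner ℂ ((z n : H) - v n) y) atTop (𝓝 (inner ℂ (0 : H) y)) :=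
      hd.inner tendsto_const_nhds
    rw [inner_zero_left] at h1
    have h2 := h1.add (hw y)
    simpa [inner_sub_left] using h2
  let u : ℕ → T.domain := fun n => ((‖(z n : H)‖⁻¹ : ℝ) : ℂ) • z n
  have hu1 : ∀ n, ‖(u n : H)‖ = 1 := by
    intro n
    simp only [u, Submodule.coe_smul, norm_smul, Complex.norm_real, norm_inv, norm_norm]
    exact inv_mul_cancel₀ (hpos n).ne'
  have hinv : ∀ n, ‖(z n : H)‖⁻¹ ≤ 2 := by
    intro n
    rw [inv_le_comm₀ (hpos n) (by norm_num)]
    simpa using hhalf n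
  have huw : WeakNull (fun n => (u n : H)) := by
    intro y
    have h1 := (tendsto_zero_iff_norm_tendsto_zero.1 (hwz y)).const_mul 2
    rw [mul_zero] at h1
    rw [tendsto_zero_iff_norm_tendsto_zero]
    refine squeeze_zero (fun _ => norm_nonneg _) (fun n => ?_) h1
    simp only [u, Submodule.coe_smul, inner_smul_left, Complex.conj_ofReal, norm_mul,
      Complex.norm_real, norm_inv, norm_norm]
    exact mul_le_mul_of_nonneg_right (hinv n) (norm_nonneg _)
  have huq : ∀ n, qf T (u n) ∈ Metric.closedBall (0 : ℂ) (4 * C) := by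
    intro n
    rw [mem_closedBall_zero_iff]
    simp only [u]
    rw [qf_smul_real, norm_mul, Complex.norm_real, Real.norm_of_nonneg (by positivity)]
    have h4 : (‖(z n : H)‖⁻¹) ^ 2 ≤ 4 := by
      have := pow_le_pow_left₀ (inv_nonneg.2 (hpos n).le) (hinv n) 2
      linarith
    exact mul_le_mul h4 (hz2 n) (norm_nonneg _) (by norm_num)
  obtain ⟨l, -, φ, hφ, hl⟩ := (isCompact_closedBall (0 : ℂ) (4 * C)).tendsto_subseq huq
  exact ⟨l, fun n => u (φ n), fun n => hu1 _, fun y => (huw y).comp hφ.tendsto_atTop, hl⟩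

theorem not_finite_of_unbounded (T : H →ₗ.[ℂ] H)
    (h : ∀ C : ℝ, ∃ u : T.domain, ‖(u : H)‖ = 1 ∧ C < ‖qf T u‖) :
    ¬ FiniteDimensional ℂ T.domain := by
  intro hf
  let S := LinearMap.toContinuousLinearMap T.toFun
  obtain ⟨u, hu, hC⟩ := h ‖S‖
  have h1 : ‖qf T u‖ ≤ ‖(u : H)‖ * ‖T u‖ := norm_inner_le_norm _ _
  have h2 : ‖T u‖ ≤ ‖S‖ * ‖u‖ := S.le_opNorm u
  have h3 : ‖u‖ = 1 := hu
  rw [hu] at h1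
  rw [h3] at h2
  linarith

theorem case_univ (T : H →ₗ.[ℂ] H) (hT : numRange T = Set.univ) : (essNumRange T).Nonempty := by
  have hW : ∀ l : ℂ, ∃ u : T.domain, ‖(u : H)‖ = 1 ∧ qf T u = l := by
    intro l
    have : l ∈ numRange T := by rw [hT]; trivial
    exact this
  refine essNumRange_nonempty_of_approx T ?_ 0 ?_
  · apply not_finite_of_unbounded
    intro C
    obtain ⟨u, hu, hq⟩ := hW ((|C| + 1 : ℝ) : ℂ)
    refine ⟨u, hu, ?_⟩
    rw [hq, Complex.norm_real, Real.norm_of_nonneg (by positivity)]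
    linarith [le_abs_self C]
  · intro y hy ε hε
    by_cases hl : qf T y = 0
    · exact ⟨y, by simpa using hε, by simp [hl]⟩
    obtain ⟨u, hu, hq⟩ := hW (-(((2 / ε) ^ 2 : ℝ) : ℂ) * qf T y)
    obtain ⟨w, hw, him⟩ := phase_aux (inner ℂ (y : H) (T u) / qf T y)
      (inner ℂ (u : H) (T y) / qf T y)
    set r := (w * (inner ℂ (y : H) (T u) / qf T y) +
      (starRingEnd ℂ) w * (inner ℂ (u : H) (T y) / qf T y)).re with hr
    have hre : w * (inner ℂ (y : H) (T u) / qf T y) +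
      (starRingEnd ℂ) w * (inner ℂ (u : H) (T y) / qf T y) = (r : ℂ) :=
      Complex.ext (by simp [hr]) (by simpa using him)
    have hre2 : w * inner ℂ (y : H) (T u) + (starRingEnd ℂ) w * inner ℂ (u : H) (T y)
        = r * qf T y := by
      rw [← hre]; field_simp
    obtain ⟨t, ht, hroot⟩ := root_aux 1 (r * (ε / 2))
    have hww : (starRingEnd ℂ) w * w = 1 := by
      rw [mul_comm, Complex.mul_conj, Complex.normSq_eq_norm_sq, hw]; simp
    refine ⟨y + (((t * (ε / 2) : ℝ) : ℂ) * w) • u, ?_, ?_⟩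
    · rw [Submodule.coe_add, Submodule.coe_smul, add_sub_cancel_left, norm_smul, norm_mul, hw, hu,
        Complex.norm_real, Real.norm_eq_abs, abs_mul, abs_of_pos (by positivity : 0 < ε / 2)]
      nlinarith
    · have hε' : (ε : ℂ) ≠ 0 := by exact_mod_cast hε.ne'
      have hrootc : (1 : ℂ) + r * (ε / 2) * t - 1 * t ^ 2 = 0 := by exact_mod_cast hroot
      have : qf T (y + (((t * (ε / 2) : ℝ) : ℂ) * w) • u) = 0 := by
        rw [qf_add_smul, hq, map_mul, Complex.conj_ofReal]
        push_cast
        have e : ∀ A B Q : ℂ, w * A + (starRingEnd ℂ) w * B = r * Q →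
            Q + t * (ε / 2) * w * A + t * (ε / 2) * (starRingEnd ℂ) w * B +
            t * (ε / 2) * (starRingEnd ℂ) w * (t * (ε / 2) * w) * (-(2 / ε) ^ 2 * Q) = 0 := by
          intro A B Q h
          have h5 : ((ε : ℂ) / 2) ^ 2 * (2 / ε) ^ 2 = 1 := by field_simp
          linear_combination (t * ((ε : ℂ) / 2)) * h + Q * hrootc
            - Q * t ^ 2 * ((starRingEnd ℂ) w * w) * h5 - Q * t ^ 2 * hww
        exact e _ _ _ hre2
      rw [this, norm_zero]

theorem case_strip (T : H →ₗ.[ℂ] H) (θ α β : ℝ) (hab : α ≤ β)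
    (hT : closure (numRange T) = {z : ℂ | α ≤ (Complex.exp (θ * Complex.I) * z).re ∧
              (Complex.exp (θ * Complex.I) * z).re ≤ β}) : (essNumRange T).Nonempty := by
  set e := Complex.exp (θ * Complex.I) with he
  have hen : ‖e‖ = 1 := Complex.norm_exp_ofReal_mul_I θ
  have he0 : e ≠ 0 := Complex.exp_ne_zero _
  have hW : ∀ M : ℝ, ∃ u : T.domain, ‖(u : H)‖ = 1 ∧ |(e * qf T u).im - M| < 1 := by
    intro M
    have hm : e⁻¹ * (⟨α, M⟩ : ℂ) ∈ closure (numRange T) := by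
      rw [hT, Set.mem_ofPred_eq, mul_inv_cancel_left₀ he0]
      exact ⟨le_rfl, hab⟩
    obtain ⟨z, ⟨u, hu, rfl⟩, hz⟩ := Metric.mem_closure_iff.1 hm 1 one_pos
    refine ⟨u, hu, ?_⟩
    have h1 : ‖e * qf T u - ⟨α, M⟩‖ < 1 := by
      have h2 : e * qf T u - ⟨α, M⟩ = e * (qf T u - e⁻¹ * ⟨α, M⟩) := by
        rw [mul_sub, mul_inv_cancel_left₀ he0]
      rw [h2, norm_mul, hen, one_mul, ← dist_eq_norm, dist_comm]
      exact hz
    have h3 := Complex.abs_im_le_norm (e * qf T u - ⟨α, M⟩)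
    simp only [Complex.sub_im] at h3
    linarith
  have hre1 : ∀ u : T.domain, ‖(u : H)‖ = 1 → |(e * qf T u).re| ≤ max |α| |β| := by
    intro u hu
    have hm : qf T u ∈ closure (numRange T) := subset_closure ⟨u, hu, rfl⟩
    rw [hT] at hm
    exact abs_le_max_abs_abs hm.1 hm.2
  have hre : ∀ x : T.domain, |(e * qf T x).re| ≤ max |α| |β| * ‖(x : H)‖ ^ 2 := by
    intro x
    by_cases hx : (x : H) = 0
    · have hx0 : x = 0 := Subtype.ext hx
      simp [qf, hx0]
    have hn : ‖(x : H)‖ ≠ 0 := norm_ne_zero_iff.2 hx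
    have h1 := hre1 (((‖(x : H)‖⁻¹ : ℝ) : ℂ) • x) (by
      simp only [Submodule.coe_smul, norm_smul, Complex.norm_real, norm_inv, norm_norm]
      exact inv_mul_cancel₀ hn)
    rw [qf_smul_real, mul_left_comm, Complex.re_ofReal_mul, abs_mul,
      abs_of_nonneg (by positivity : 0 ≤ ‖(x : H)‖⁻¹ ^ 2)] at h1
    have h2 := mul_le_mul_of_nonneg_right h1 (sq_nonneg ‖(x : H)‖)
    have h3 : ‖(x : H)‖⁻¹ ^ 2 * |(e * qf T x).re| * ‖(x : H)‖ ^ 2 = |(e * qf T x).re| := by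
      field_simp
    linarith
  have hD : ¬ FiniteDimensional ℂ T.domain := by
    apply not_finite_of_unbounded
    intro C
    obtain ⟨u, hu, hq⟩ := hW (C + 1)
    refine ⟨u, hu, ?_⟩
    have h1 : ‖e * qf T u‖ = ‖qf T u‖ := by rw [norm_mul, hen, one_mul]
    have h3 := Complex.abs_im_le_norm (e * qf T u)
    have h4 := le_abs_self (e * qf T u).im
    have h5 := abs_lt.1 hq
    linarith [h5.1]
  have hm0 : 0 ≤ max |α| |β| := (abs_nonneg _).trans (le_max_left _ _)
  -- reduce to vanishing imaginary part
  refine essNumRange_nonempty_of_approx T hD (max |α| |β| * 4) ?_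
  intro y hy ε hε
  suffices hs : ∃ z : T.domain, ‖(z : H) - y‖ < min ε 1 ∧ (e * qf T z).im = 0 by
    obtain ⟨z, hz, h0⟩ := hs
    refine ⟨z, hz.trans_le (min_le_left _ _), ?_⟩
    have h1 : ‖e * qf T z‖ = ‖qf T z‖ := by rw [norm_mul, hen, one_mul]
    have h2 := Complex.norm_le_abs_re_add_abs_im (e * qf T z)
    rw [h0, abs_zero, add_zero, h1] at h2
    have h3 : ‖(z : H)‖ ≤ 2 := by
      have := norm_sub_norm_le (z : H) (y : H)
      have := hz.trans_le (min_le_right _ _)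
      linarith
    have h4 : ‖(z : H)‖ ^ 2 ≤ 4 := by
      have := pow_le_pow_left₀ (norm_nonneg _) h3 2
      linarith
    exact h2.trans ((hre z).trans (mul_le_mul_of_nonneg_left h4 hm0))
  have hδ : 0 < min ε 1 := lt_min hε one_pos
  set δ := min ε 1 with hδd
  set b := (e * qf T y).im with hb
  by_cases hb0 : b = 0
  · exact ⟨y, by simpa using hδ, hb0⟩
  have hbp : 0 < |b| := abs_pos.2 hb0
  obtain ⟨u, hu, hq⟩ := hW (-b * ((2 / δ) ^ 2 + 1 / |b|))
  set m := (e * qf T u).im with hm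
  set s := -m / b with hsd
  have hmb : m = -b * s := by rw [hsd]; field_simp
  have hs : (2 / δ) ^ 2 ≤ s := by
    have h1 : m - -b * ((2 / δ) ^ 2 + 1 / |b|) = -b * (s - ((2 / δ) ^ 2 + 1 / |b|)) := by
      rw [hmb]; ring
    rw [h1, abs_mul, abs_neg] at hq
    have h2 : |s - ((2 / δ) ^ 2 + 1 / |b|)| < 1 / |b| := by
      rw [lt_div_iff₀ hbp, mul_comm]; exact hq
    linarith [(abs_lt.1 h2).1]
  have hsp : 0 < s := lt_of_lt_of_le (by positivity) hs
  set k := (Real.sqrt s)⁻¹ with hk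
  have hsq : 2 / δ ≤ Real.sqrt s := Real.le_sqrt_of_sq_le hs
  have hkp : 0 < k := inv_pos.2 (Real.sqrt_pos.2 hsp)
  have hkδ : k < δ := by
    have h1 : k ≤ (2 / δ)⁻¹ := inv_anti₀ (by positivity) hsq
    rw [inv_div] at h1
    linarith
  have hks : k ^ 2 * s = 1 := by
    rw [hk, inv_pow, Real.sq_sqrt hsp.le]; exact inv_mul_cancel₀ hsp.ne'
  obtain ⟨t, ht, hroot⟩ := root_aux b
    (k * (e * (inner ℂ (y : H) (T u) + inner ℂ (u : H) (T y))).im)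
  refine ⟨y + ((t * k : ℝ) : ℂ) • u, ?_, ?_⟩
  · rw [Submodule.coe_add, Submodule.coe_smul, add_sub_cancel_left, norm_smul, hu,
      Complex.norm_real, Real.norm_eq_abs, abs_mul, abs_of_pos hkp]
    nlinarith
  · have h1 : e * qf T (y + ((t * k : ℝ) : ℂ) • u) = e * qf T y
        + ((t * k : ℝ) : ℂ) * (e * (inner ℂ (y : H) (T u) + inner ℂ (u : H) (T y)))
        + (((t * k) ^ 2 : ℝ) : ℂ) * (e * qf T u) := by
      rw [qf_add_smul, Complex.conj_ofReal]; push_cast; ring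
    rw [h1, Complex.add_im, Complex.add_im, Complex.im_ofReal_mul, Complex.im_ofReal_mul, ← hb,
      ← hm, hmb]
    linear_combination hroot - b * t ^ 2 * hks

theorem case_nonclosable (T : H →ₗ.[ℂ] H) (hinf : ¬FiniteDimensional ℂ H)
    (hd : Dense (T.domain : Set H)) (hc : ¬IsClosableSeq T) : (essNumRange T).Nonempty := by
  unfold IsClosableSeq at hc
  push Not at hc
  obtain ⟨x, v, hx, hTx, hv⟩ := hc
  refine essNumRange_nonempty_of_approx T ?_ 1 ?_
  · intro hf
    have hcl : IsClosed (T.domain : Set H) := Submodule.closed_of_finiteDimensional _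
    have htop : T.domain = ⊤ := by
      rw [← SetLike.coe_set_eq, ← hcl.closure_eq, hd.closure_eq]; rfl
    rw [htop] at hf
    exact hinf (Module.finite_def.2 (Submodule.fg_top _ |>.1 (Module.finite_def.1 hf) |> fun h => by simpa using h))
  -- nonorthogonal vectors
  have key : ∀ y : T.domain, inner ℂ (y : H) v ≠ 0 → ∀ ε : ℝ, 0 < ε →
      ∃ z : T.domain, ‖(z : H) - y‖ < ε ∧ ‖qf T z‖ ≤ 1 := by
    intro y hy ε hε
    set s : ℂ := - qf T y / inner ℂ (y : H) v with hs
    have h1 : Tendsto (fun n => inner ℂ (y : H) (T (x n))) atTop (𝓝 (inner ℂ (y : H) v)) :=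
      tendsto_const_nhds.inner hTx
    have h2 : Tendsto (fun n => inner ℂ (x n : H) (T y)) atTop (𝓝 (inner ℂ (0 : H) (T y))) :=
      hx.inner tendsto_const_nhds
    have h3 : Tendsto (fun n => qf T (x n)) atTop (𝓝 (inner ℂ (0 : H) v)) :=
      hx.inner hTx
    rw [inner_zero_left] at h2 h3
    have h4 : Tendsto (fun n => qf T (y + s • x n)) atTop (𝓝 0) := by
      simp only [qf_add_smul]
      have := ((tendsto_const_nhds (x := qf T y)).add (h1.const_mul s)).add
        (h2.const_mul ((starRingEnd ℂ) s)) |>.add (h3.const_mul ((starRingEnd ℂ) s * s))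
      convert this using 2
      rw [hs]; field_simp; simp
    have h5 : Tendsto (fun n => s • (x n : H)) atTop (𝓝 0) := by
      simpa using hx.const_smul s
    have h6 := h4.norm.eventually_lt_const (u := (1 : ℝ)) (by simp)
    have h7 := h5.norm.eventually_lt_const (u := ε) (by simpa using hε)
    obtain ⟨n, hn6, hn7⟩ := (h6.and h7).exists
    exact ⟨y + s • x n, by simpa [add_sub_cancel_left] using hn7, hn6.le⟩
  obtain ⟨g, hg⟩ : ∃ g : T.domain, inner ℂ (g : H) v ≠ 0 := by
    by_contra hcon
    push Not at hcon
    apply hv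
    exact hd.eq_zero_of_inner_right ℂ (fun w hw => hcon ⟨w, hw⟩)
  intro y _ ε hε
  by_cases hy : inner ℂ (y : H) v = 0
  · set δ : ℝ := (ε / 2) / (‖(g : H)‖ + 1) with hδ
    have hδp : 0 < δ := by positivity
    have hδ2 : δ * ‖(g : H)‖ ≤ ε / 2 := by
      rw [hδ, div_mul_eq_mul_div, div_le_iff₀ (by positivity)]
      nlinarith [norm_nonneg (g : H)]
    have hne : inner ℂ ((y + (δ : ℂ) • g : T.domain) : H) v ≠ 0 := by
      rw [Submodule.coe_add, Submodule.coe_smul, inner_add_left, hy, zero_add, inner_smul_left,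
        Complex.conj_ofReal]
      exact mul_ne_zero (by exact_mod_cast hδp.ne') hg
    obtain ⟨z, hz, hq⟩ := key _ hne (ε / 2) (by positivity)
    refine ⟨z, ?_, hq⟩
    have h1 : (z : H) - y = ((z : H) - ((y + (δ : ℂ) • g : T.domain) : H)) + (δ : ℂ) • (g : H) := by
      rw [Submodule.coe_add, Submodule.coe_smul]; abel
    rw [h1]
    refine (norm_add_le _ _).trans_lt ?_
    rw [norm_smul, Complex.norm_real, Real.norm_of_nonneg hδp.le]
    linarith
  · exact key y hy ε hε

/-- Prop. 2.3: if `W(T) = ℂ`, or the closure of `W(T)` is a (possibly degenerate)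
closed strip, then `W_e(T) ≠ ∅`; in particular this holds if `T` is densely defined
and not closable. -/
theorem essNumRange_nonempty_of_strip_or_univ
    [TopologicalSpace.SeparableSpace H] (hinf : ¬FiniteDimensional ℂ H)
    (T : H →ₗ.[ℂ] H) :
    ((numRange T = Set.univ ∨
        ∃ (θ α β : ℝ), α ≤ β ∧
          closure (numRange T) =
            {z : ℂ | α ≤ (Complex.exp (θ * Complex.I) * z).re ∧
              (Complex.exp (θ * Complex.I) * z).re ≤ β}) →
      (essNumRange T).Nonempty) ∧
    ((Dense (T.domain : Set H) ∧ ¬IsClosableSeq T) → (essNumRange T).Nonempty) := by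
  refine ⟨?_, fun h => case_nonclosable T hinf h.1 h.2⟩
  rintro (h | ⟨θ, α, β, hab, h⟩)
  · exact case_univ T h
  · exact case_strip T θ α β hab h
end
end

section
/- Let T be a linear operator in H. If z ∈ W_e(T) and w ∈ ℂ \ {0} are such that z + tw ∈ W(T) for all real t > 0, then z + tw ∈ W_e(T) for all real t ≥ 0. -/
open Filter Topology

noncomputable section

variable {H : Type*} [NormedAddCommGroup H] [InnerProductSpace ℂ H] [CompleteSpace H]

/-- A domain sequence with norms tending to one can be normalised. -/
lemma mem_essNumRange_of_norm_tendsto (T : H →ₗ.[ℂ] H) (lam : ℂ) (u : ℕ → T.domain)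
    (hn : Tendsto (fun n => ‖(u n : H)‖) atTop (nhds 1))
    (hu : WeakNull (fun n => (u n : H)))
    (hT : Tendsto (fun n => (inner ℂ (u n : H) (T (u n)) : ℂ)) atTop (nhds lam)) :
    lam ∈ essNumRange T := by
  have hpos : ∀ᶠ n in atTop, 0 < ‖(u n : H)‖ := hn.eventually (lt_mem_nhds one_pos)
  obtain ⟨N, hN⟩ := eventually_atTop.1 hpos
  have hinv : Tendsto (fun n => ((‖(u n : H)‖⁻¹ : ℝ) : ℂ)) atTop (nhds 1) := by
    have h1 := hn.inv₀ one_ne_zero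
    have h2 := (Complex.continuous_ofReal.tendsto _).comp h1
    simpa [Function.comp_def] using h2
  refine ⟨fun n => ((‖(u (n + N) : H)‖⁻¹ : ℝ) : ℂ) • u (n + N), ?_, ?_, ?_⟩
  · intro n
    have h := hN (n + N) (by omega)
    simp [norm_smul, h.ne']
  · intro y
    have h := (hinv.mul (hu y)).comp (tendsto_add_atTop_nat N)
    simpa [Function.comp_def, inner_smul_left, mul_comm] using h
  · have h := (hinv.mul (hinv.mul hT)).comp (tendsto_add_atTop_nat N)
    simpa [Function.comp_def, inner_smul_left, inner_smul_right, LinearPMap.map_smul, mul_comm] using h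

/-- Choice of the coefficient: `conj β * c + |β|^2 M w = t w` with `|β|^2 M ≤ t`. -/
lemma exists_coeff (t M : ℝ) (ht : 0 ≤ t) (hM : 0 < M) (w c : ℂ) (hw : w ≠ 0) :
    ∃ b : ℂ, ‖b‖ ^ 2 * M ≤ t ∧
      (starRingEnd ℂ) b * c + (starRingEnd ℂ) b * b * (M * w) = t * w := by
  have hw' : 0 < ‖w‖ := norm_pos_iff.2 hw
  obtain ⟨r, hr, hreq⟩ : ∃ r ∈ Set.Icc (0:ℝ) (√(t / M)), r ^ 2 * M + r * (‖c‖ / ‖w‖) = t := by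
    have hcont : ContinuousOn (fun r : ℝ => r ^ 2 * M + r * (‖c‖ / ‖w‖))
        (Set.Icc (0:ℝ) (√(t / M))) := by fun_prop
    have := intermediate_value_Icc (Real.sqrt_nonneg (t / M)) hcont
    refine this ⟨by simpa using ht, ?_⟩
    have h1 : √(t / M) ^ 2 * M = t := by
      rw [Real.sq_sqrt (by positivity)]; field_simp
    have h2 : 0 ≤ √(t / M) * (‖c‖ / ‖w‖) := by positivity
    show t ≤ √(t / M) ^ 2 * M + √(t / M) * (‖c‖ / ‖w‖)
    linarith
  have hr0 := hr.1
  -- a unit phase `p` with `p * c = ‖c‖ / ‖w‖ * w`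
  obtain ⟨p, hp, hpc⟩ : ∃ p : ℂ, ‖p‖ = 1 ∧ p * c = (‖c‖ / ‖w‖ : ℝ) * w := by
    by_cases hc : c = 0
    · exact ⟨1, by simp, by simp [hc]⟩
    · have hc' : ‖c‖ ≠ 0 := norm_ne_zero_iff.2 hc
      refine ⟨(‖c‖ / ‖w‖ : ℝ) * w / c, ?_, by field_simp⟩
      rw [norm_div, norm_mul, Complex.norm_real, Real.norm_of_nonneg (by positivity)]
      field_simp
  refine ⟨(starRingEnd ℂ) (r * p), ?_, ?_⟩
  · have : ‖(starRingEnd ℂ) (r * p)‖ = r := by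
      rw [RCLike.norm_conj, norm_mul, hp, Complex.norm_real, Real.norm_of_nonneg hr0, mul_one]
    rw [this]
    have : 0 ≤ r * (‖c‖ / ‖w‖) := by positivity
    linarith
  · have hpp : p * (starRingEnd ℂ) p = 1 := by
      rw [Complex.mul_conj, Complex.normSq_eq_norm_sq, hp]; simp
    have hreq' : (r : ℂ) ^ 2 * M + r * ((‖c‖ / ‖w‖ : ℝ) : ℂ) = t := by exact_mod_cast hreq
    simp only [Complex.conj_conj, map_mul, Complex.conj_ofReal]
    linear_combination (r : ℂ) * hpc + (r : ℂ) ^ 2 * M * w * hpp + w * hreq'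

theorem ray_subset_essNumRange
    [TopologicalSpace.SeparableSpace H] (hinf : ¬FiniteDimensional ℂ H)
    (T : H →ₗ.[ℂ] H) (z w : ℂ) (hz : z ∈ essNumRange T) (hw : w ≠ 0)
    (hray : ∀ t : ℝ, 0 < t → z + (t : ℂ) * w ∈ numRange T) :
    ∀ t : ℝ, 0 ≤ t → z + (t : ℂ) * w ∈ essNumRange T := by
  intro t ht
  obtain ⟨x, hx1, hx0, hxT⟩ := hz
  have key : ∀ m : ℕ, ∃ (n : ℕ) (b : ℂ) (y : T.domain), m ≤ n ∧ ‖(y : H)‖ = 1 ∧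
      ‖b‖ ^ 2 * ((m : ℝ) + 1) ≤ t ∧
      ‖(inner ℂ ((x n + b • y : T.domain) : H) (T (x n + b • y)) : ℂ)
        - z * inner ℂ ((x n + b • y : T.domain) : H) ((x n + b • y : T.domain) : H) - t * w
        - (inner ℂ (x n : H) (T (x n)) - z)‖ ≤ ‖b‖ := by
    intro m
    obtain ⟨y, hy1, hyT⟩ := hray (m + 1) (by positivity)
    have hd : Tendsto (fun n => (inner ℂ (x n : H) (T y - z • (y : H)) : ℂ)) atTop (nhds 0) :=
      hx0 _
    have hd' : ∀ᶠ n in atTop, ‖(inner ℂ (x n : H) (T y - z • (y : H)) : ℂ)‖ < 1 := by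
      have := hd.norm
      rw [norm_zero] at this
      exact this.eventually (gt_mem_nhds one_pos)
    obtain ⟨n, hn, hmn⟩ := (hd'.and (eventually_ge_atTop m)).exists
    obtain ⟨b, hb, hbeq⟩ := exists_coeff t (m + 1) ht (by positivity) w
      (inner ℂ (y : H) (T (x n)) - z * inner ℂ (y : H) (x n : H)) hw
    refine ⟨n, b, y, hmn, hy1, hb, ?_⟩
    have hxx : (inner ℂ (x n : H) (x n : H) : ℂ) = 1 := by
      rw [inner_self_eq_norm_sq_to_K, hx1]; simp
    have hyy : (inner ℂ (y : H) (y : H) : ℂ) = 1 := by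
      rw [inner_self_eq_norm_sq_to_K, hy1]; simp
    have : (inner ℂ ((x n + b • y : T.domain) : H) (T (x n + b • y)) : ℂ)
        - z * inner ℂ ((x n + b • y : T.domain) : H) ((x n + b • y : T.domain) : H) - t * w
        - (inner ℂ (x n : H) (T (x n)) - z) = b * inner ℂ (x n : H) (T y - z • (y : H)) := by
      simp only [LinearPMap.map_add, LinearPMap.map_smul, Submodule.coe_add, Submodule.coe_smul,
        inner_add_left, inner_add_right, inner_smul_left, inner_smul_right, inner_sub_right,
        hxx, hyy, hyT]
      push_cast at hbeq ⊢
      linear_combination hbeq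
    rw [this, norm_mul]
    exact mul_le_of_le_one_right (norm_nonneg _) hn.le
  choose n b y hmn hy1 hb hB using key
  have hntop : Tendsto n atTop atTop := tendsto_atTop_mono hmn tendsto_id
  have hbn : Tendsto (fun m => ‖b m‖) atTop (nhds 0) := by
    have h1 : Tendsto (fun m : ℕ => √(t * (1 / ((m : ℝ) + 1)))) atTop (nhds 0) := by
      have := (tendsto_one_div_add_atTop_nhds_zero_nat (𝕜 := ℝ)).const_mul t
      have := this.sqrt
      simpa using this
    refine squeeze_zero (fun _ => norm_nonneg _) (fun m => ?_) h1
    apply Real.le_sqrt_of_sq_le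
    rw [mul_one_div, le_div_iff₀ (by positivity)]
    exact hb m
  have hby : Tendsto (fun m => b m • (y m : H)) atTop (nhds 0) := by
    rw [tendsto_zero_iff_norm_tendsto_zero]
    simpa [norm_smul, hy1] using hbn
  have hnorm : Tendsto (fun m => ‖((x (n m) + b m • y m : T.domain) : H)‖) atTop (nhds 1) := by
    rw [tendsto_iff_norm_sub_tendsto_zero]
    refine squeeze_zero (fun _ => norm_nonneg _) (fun m => ?_) hbn
    have h := abs_norm_sub_norm_le ((x (n m) + b m • y m : T.domain) : H) (x (n m) : H)
    rw [hx1] at h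
    simpa [norm_smul, hy1] using h
  refine mem_essNumRange_of_norm_tendsto T _ (fun m => x (n m) + b m • y m) hnorm ?_ ?_
  · intro v
    have h1 := (hx0 v).comp hntop
    have h2 : Tendsto (fun m => (inner ℂ (b m • (y m : H)) v : ℂ)) atTop (nhds 0) := by
      have h3 := hby.inner (𝕜 := ℂ) (tendsto_const_nhds (x := v))
      rw [inner_zero_left] at h3
      exact h3
    simpa [Function.comp_def, inner_add_left] using h1.add h2
  · have h0 := squeeze_zero_norm hB hbn
    have h1 := hxT.comp hntop
    have h2 : Tendsto (fun m => (inner ℂ ((x (n m) + b m • y m : T.domain) : H)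
        ((x (n m) + b m • y m : T.domain) : H) : ℂ)) atTop (nhds 1) := by
      have h3 := (Complex.continuous_ofReal.tendsto _).comp (hnorm.pow 2)
      simp only [inner_self_eq_norm_sq_to_K]
      simpa [Function.comp_def] using h3
    have h4 := ((h0.add h1).add (h2.const_mul z)).add_const (t * w - z)
    convert h4 using 2
    · simp only [Function.comp_def]; ring
    · ring
end
end

section
/- Let T be a linear operator in H with W(T) = ℂ, and let y ∈ dom(T) with ‖y‖ = 1 be such that {y}^⊥ ∩ dom(T) ≠ {0}. Then for every ε > 0 there exists w ∈ dom(T) with ‖w‖ = 1 such that W(T|_{{w}^⊥ ∩ dom(T)}) = ℂ and |⟨Tw, w⟩ − ⟨Ty, y⟩| < ε. -/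
open Filter Topology

noncomputable section

variable {H : Type*} [NormedAddCommGroup H] [InnerProductSpace ℂ H] [CompleteSpace H]

theorem th_phase (p q : ℂ) : ∃ ω : ℂ, ‖ω‖ = 1 ∧ (ω * p + (starRingEnd ℂ) ω * q).im = 0 := by
  obtain ⟨ω, h1, h2⟩ : ∃ ω : ℂ, ‖ω‖ = 1 ∧ ω * (p - (starRingEnd ℂ) q) = ‖p - (starRingEnd ℂ) q‖ := by
    by_cases h : p - (starRingEnd ℂ) q = 0
    · exact ⟨1, by simp, by simp [h]⟩
    · have hn : ((‖p - (starRingEnd ℂ) q‖ : ℝ) : ℂ) ≠ 0 := by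
        exact_mod_cast norm_ne_zero_iff.mpr h
      refine ⟨(starRingEnd ℂ) (p - (starRingEnd ℂ) q) / ‖p - (starRingEnd ℂ) q‖, ?_, ?_⟩
      · rw [norm_div, RCLike.norm_conj]
        simp [norm_ne_zero_iff.mpr h]
      · rw [div_mul_eq_mul_div, Complex.conj_mul', sq, mul_div_assoc, div_self hn, mul_one]
  refine ⟨ω, h1, ?_⟩
  have := congrArg Complex.im h2
  simp at this ⊢
  linarith

theorem numRange_convex (T : H →ₗ.[ℂ] H) : Convex ℝ (numRange T) := by
  rintro a ⟨x, hx, hxa⟩ b ⟨y, hy, hyb⟩ s t hs ht hst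
  by_cases hab : a = b
  · refine ⟨x, hx, ?_⟩
    rw [hxa, ← hab, ← add_smul, hst, one_smul]
  have hba : b - a ≠ 0 := sub_ne_zero.mpr (Ne.symm hab)
  have hxx : inner ℂ (x : H) (x : H) = (1 : ℂ) := by
    rw [inner_self_eq_norm_sq_to_K, hx]; simp
  have hyy : inner ℂ (y : H) (y : H) = (1 : ℂ) := by
    rw [inner_self_eq_norm_sq_to_K, hy]; simp
  set B : T.domain → T.domain → ℂ := fun u v =>
    (inner ℂ (u : H) (T v) - a * inner ℂ (u : H) (v : H)) / (b - a) with hB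
  have Bxx : B x x = 0 := by simp [hB, hxa, hx]
  have Byy : B y y = 1 := by simp [hB, hyb, hy, hba]
  have Bexp : ∀ c d : ℂ, B (c • x + d • y) (c • x + d • y) =
      (starRingEnd ℂ) d * d + ((starRingEnd ℂ) c * d * B x y + (starRingEnd ℂ) d * c * B y x) := by
    intro c d
    have : B (c • x + d • y) (c • x + d • y) = (starRingEnd ℂ) c * c * B x x
      + (starRingEnd ℂ) d * d * B y y +
      ((starRingEnd ℂ) c * d * B x y + (starRingEnd ℂ) d * c * B y x) := by
      simp only [hB, LinearPMap.map_add, LinearPMap.map_smul, Submodule.coe_add, Submodule.coe_smul,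
        inner_add_left, inner_add_right, inner_smul_left, inner_smul_right]
      field_simp
      ring
    rw [this, Bxx, Byy]; ring
  obtain ⟨ω, hω, hκ⟩ := th_phase (B x y) (B y x)
  set k : ℂ := ω * B x y + (starRingEnd ℂ) ω * B y x with hk
  have hkr : k = (k.re : ℂ) := by
    apply Complex.ext <;> simp [hκ]
  have hωω : (starRingEnd ℂ) ω * ω = 1 := by
    rw [Complex.conj_mul', hω]; simp
  set f : ℝ → T.domain := fun r => ((1 - r : ℝ) : ℂ) • x + ((r : ℂ) * ω) • y with hf
  have Bf : ∀ r : ℝ, B (f r) (f r) = ((r ^ 2 + r * (1 - r) * k.re : ℝ) : ℂ) := by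
    intro r
    simp only [hf]
    rw [Bexp]
    simp only [map_mul, Complex.conj_ofReal]
    push_cast
    rw [← hkr, hk]
    linear_combination (r : ℂ) ^ 2 * hωω
  have hcont : Continuous (fun r : ℝ => (r ^ 2 + r * (1 - r) * k.re) - t * ‖(f r : H)‖ ^ 2) := by
    simp only [hf, Submodule.coe_add, Submodule.coe_smul]
    fun_prop
  obtain ⟨r, -, hr⟩ : (0 : ℝ) ∈ (fun r : ℝ => (r ^ 2 + r * (1 - r) * k.re) - t * ‖(f r : H)‖ ^ 2) ''
      Set.Icc 0 1 := by
    apply intermediate_value_Icc zero_le_one hcont.continuousOn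
    simp [hf, hx, hy, norm_smul, hω]
    constructor <;> linarith
  have hr' : r ^ 2 + r * (1 - r) * k.re = t * ‖(f r : H)‖ ^ 2 := by
    have := hr
    simp only at this
    linarith
  have hne : (f r : H) ≠ 0 := by
    intro h0
    have h1 : ((1 - r : ℝ) : ℂ) • x = (-((r : ℂ) * ω)) • y := by
      have : f r = 0 := by exact_mod_cast h0
      rw [neg_smul]
      exact eq_neg_of_add_eq_zero_left this
    have e1 := Bexp ((1 - r : ℝ) : ℂ) 0
    have e2 := Bexp 0 (-((r : ℂ) * ω))
    simp only [zero_smul, add_zero, zero_add] at e1 e2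
    rw [← h1, e1] at e2
    simp only [map_zero, map_neg, map_mul, Complex.conj_ofReal] at e2
    have e3 : (r : ℂ) ^ 2 = 0 := by linear_combination -e2 - (r : ℂ) ^ 2 * hωω
    have e4 : r = 0 := by
      have := pow_eq_zero_iff (two_ne_zero) |>.mp e3
      exact_mod_cast this
    rw [e4] at h1
    simp at h1
    rw [h1] at hx
    simp at hx
  have hn : ((‖(f r : H)‖ : ℝ) : ℂ) ≠ 0 := by exact_mod_cast norm_ne_zero_iff.mpr hne
  refine ⟨((‖(f r : H)‖ : ℝ) : ℂ)⁻¹ • f r, ?_, ?_⟩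
  · rw [Submodule.coe_smul, norm_smul]
    simp [norm_ne_zero_iff.mpr hne]
  · rw [LinearPMap.map_smul, Submodule.coe_smul, inner_smul_left, inner_smul_right, map_inv₀,
      Complex.conj_ofReal]
    have h2 : B (f r) (f r) = ((t * ‖(f r : H)‖ ^ 2 : ℝ) : ℂ) := by rw [Bf, hr']
    simp only [hB] at h2
    rw [inner_self_eq_norm_sq_to_K, div_eq_iff hba] at h2
    have h3 : inner ℂ (f r : H) (T (f r)) =
      ((‖(f r : H)‖ : ℝ) : ℂ) ^ 2 * (t * (b - a) + a) := by
      push_cast at h2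
      simp only [Complex.coe_algebraMap] at h2
      linear_combination h2
    rw [h3]
    have hs' : (s : ℂ) = 1 - t := by rw [eq_sub_of_add_eq hst]; push_cast; ring
    simp only [Complex.real_smul, hs']
    field_simp
    ring

theorem closure_ne_univ {s : Set ℂ} (hs : Convex ℝ s) (h : s ≠ Set.univ) :
    closure s ≠ Set.univ := by
  intro hc
  by_cases hi : (interior s).Nonempty
  · have := hs.interior_closure_eq_interior_of_nonempty_interior hi
    rw [hc, interior_univ] at this
    exact h (Set.univ_subset_iff.mp (this ▸ interior_subset))
  · rw [hs.interior_nonempty_iff_affineSpan_eq_top] at hi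
    apply hi
    have h1 : closure s ⊆ (affineSpan ℝ s : Set ℂ) :=
      closure_minimal (subset_affineSpan ℝ s) (AffineSubspace.closed_of_finiteDimensional _)
    rw [hc] at h1
    exact SetLike.coe_injective (Set.univ_subset_iff.mp h1)

theorem half_plane (T : H →ₗ.[ℂ] H) (h : numRange T ≠ Set.univ) :
    ∃ l : ℂ, ‖l‖ = 1 ∧ ∃ C : ℝ, 0 ≤ C ∧
      ∀ x : T.domain, -C * ‖(x : H)‖ ^ 2 ≤ (l * inner ℂ (x : H) (T x)).re := by
  -- suffices to bound on unit vectors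
  suffices hh : ∃ l : ℂ, ‖l‖ = 1 ∧ ∃ C : ℝ, ∀ z ∈ numRange T, -C ≤ (l * z).re by
    obtain ⟨l, hl, C, hC⟩ := hh
    refine ⟨l, hl, |C|, abs_nonneg _, fun x => ?_⟩
    by_cases hx : (x : H) = 0
    · simp [hx]
    have hn := norm_ne_zero_iff.mpr hx
    have := hC _ ⟨((‖(x : H)‖ : ℝ) : ℂ)⁻¹ • x, by
      rw [Submodule.coe_smul, norm_smul]; simp [hn], rfl⟩
    rw [LinearPMap.map_smul, Submodule.coe_smul, inner_smul_left, inner_smul_right, map_inv₀,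
      Complex.conj_ofReal] at this
    have e : l * ((((‖(x : H)‖ : ℝ) : ℂ))⁻¹ * ((((‖(x : H)‖ : ℝ) : ℂ))⁻¹ * inner ℂ (x : H) (T x)))
      = (((‖(x : H)‖ ^ 2)⁻¹ : ℝ) : ℂ) * (l * inner ℂ (x : H) (T x)) := by
      push_cast; ring
    rw [e, Complex.re_ofReal_mul] at this
    have hp : 0 < ‖(x : H)‖ ^ 2 := by positivity
    have h2 : -|C| ≤ (‖(x : H)‖ ^ 2)⁻¹ * (l * inner ℂ (x : H) (T x)).re :=
      le_trans (neg_le_neg (le_abs_self C)) this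
    rw [inv_mul_eq_div, le_div_iff₀ hp] at h2
    exact h2
  have hcl := closure_ne_univ (numRange_convex T) h
  obtain ⟨p, hp⟩ := (Set.ne_univ_iff_exists_notMem _).mp hcl
  obtain ⟨f, u, h1, h2⟩ := RCLike.geometric_hahn_banach_point_closed (𝕜 := ℂ)
    (numRange_convex T).closure isClosed_closure hp
  have hf : ∀ z, f z = f 1 * z := fun z => by
    have := f.map_smul z 1
    simp at this
    rw [this, mul_comm]
  by_cases he : f 1 = 0
  · refine ⟨1, by simp, 0, fun z hz => ?_⟩
    have := h2 z (subset_closure hz)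
    rw [hf, he] at this
    rw [hf, he] at h1
    simp at h1 this
    linarith
  have hn := norm_ne_zero_iff.mpr he
  refine ⟨((‖f 1‖⁻¹ : ℝ) : ℂ) * f 1, by simp [hn], -(‖f 1‖⁻¹ * u), fun z hz => ?_⟩
  have := h2 z (subset_closure hz)
  rw [hf] at this
  rw [mul_assoc, Complex.re_ofReal_mul, neg_neg]
  have hp : 0 ≤ ‖f 1‖⁻¹ := by positivity
  exact mul_le_mul_of_nonneg_left this.le hp

theorem half_plane_restrict (T : H →ₗ.[ℂ] H) (w : H)
    (h : numRange (T.domRestrict (ℂ ∙ w)ᗮ) ≠ Set.univ) :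
    ∃ l : ℂ, ‖l‖ = 1 ∧ ∃ C : ℝ, 0 ≤ C ∧
      ∀ x : T.domain, inner ℂ w (x : H) = (0 : ℂ) →
        -C * ‖(x : H)‖ ^ 2 ≤ (l * inner ℂ (x : H) (T x)).re := by
  obtain ⟨l, hl, C, hC0, hC⟩ := half_plane _ h
  refine ⟨l, hl, C, hC0, fun x hx => ?_⟩
  have hm : (x : H) ∈ (ℂ ∙ w)ᗮ ⊓ T.domain :=
    ⟨Submodule.mem_orthogonal_singleton_iff_inner_right.mpr hx, x.2⟩
  have := hC ⟨x, hm⟩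
  have hle : T.domRestrict (ℂ ∙ w)ᗮ ≤ T := LinearPMap.domRestrict_le
  have e : T.domRestrict (ℂ ∙ w)ᗮ ⟨x, hm⟩ = T x :=
    hle.2 rfl
  rw [e] at this
  exact this

theorem lemA (T : H →ₗ.[ℂ] H) (l : ℂ) (hl : ‖l‖ = 1) (v : T.domain) (C R : ℝ) (hC : 0 ≤ C) :
    ∃ K : ℝ, ∀ z : T.domain, ‖(z : H)‖ ≤ 3 →
      (∀ g : ℂ, -C * ‖((z + g • v : T.domain) : H)‖ ^ 2 ≤
        (l * inner ℂ ((z + g • v : T.domain) : H) (T (z + g • v))).re) →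
      ∀ t : ℝ, 0 ≤ t → t ≤ R →
        -K ≤ (l * inner ℂ (z : H) (T z)).re - t * ‖(inner ℂ (v : H) (T z) : ℂ)‖ := by
  refine ⟨C * (3 + R * ‖(v : H)‖) ^ 2 + R * (3 * ‖T v‖) + R ^ 2 * (‖(v : H)‖ * ‖T v‖), ?_⟩
  intro z hz hg t ht htR
  have hR : 0 ≤ R := ht.trans htR
  obtain ⟨c, hc1, hc2⟩ : ∃ c : ℂ, ‖c‖ = 1 ∧
      c * (l * inner ℂ (v : H) (T z)) = -(‖(inner ℂ (v : H) (T z) : ℂ)‖ : ℂ) := by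
    set a := l * inner ℂ (v : H) (T z) with ha
    have hna : ‖(inner ℂ (v : H) (T z) : ℂ)‖ = ‖a‖ := by rw [ha, norm_mul, hl, one_mul]
    rw [hna]
    by_cases h : a = 0
    · exact ⟨1, by simp, by simp [h]⟩
    · have hn : ((‖a‖ : ℝ) : ℂ) ≠ 0 := by exact_mod_cast norm_ne_zero_iff.mpr h
      refine ⟨-((starRingEnd ℂ) a / ‖a‖), ?_, ?_⟩
      · rw [norm_neg, norm_div, RCLike.norm_conj]
        simp [norm_ne_zero_iff.mpr h]
      · rw [neg_mul, div_mul_eq_mul_div, Complex.conj_mul', sq, mul_div_assoc, div_self hn, mul_one]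
  set g : ℂ := (t : ℂ) * (starRingEnd ℂ) c with hgdef
  have hgn : ‖g‖ = t := by
    rw [hgdef, norm_mul, RCLike.norm_conj, hc1]; simp [abs_of_nonneg ht]
  have h := hg g
  have hexp : l * inner ℂ ((z + g • v : T.domain) : H) (T (z + g • v)) =
      l * inner ℂ (z : H) (T z) + ((-(t * ‖(inner ℂ (v : H) (T z) : ℂ)‖) : ℝ) : ℂ)
        + (l * (g * inner ℂ (z : H) (T v)) +
          l * ((starRingEnd ℂ) g * g * inner ℂ (v : H) (T v))) := by
    simp only [LinearPMap.map_add, LinearPMap.map_smul, Submodule.coe_add, Submodule.coe_smul,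
        inner_add_left, inner_add_right, inner_smul_left, inner_smul_right]
    have : (starRingEnd ℂ) g = t * c := by simp [hgdef]
    rw [this]
    push_cast
    linear_combination (t : ℂ) * hc2
  rw [hexp, Complex.add_re, Complex.add_re, Complex.ofReal_re] at h
  have b1 : (l * (g * inner ℂ (z : H) (T v)) +
          l * ((starRingEnd ℂ) g * g * inner ℂ (v : H) (T v))).re ≤
        R * (3 * ‖T v‖) + R ^ 2 * (‖(v : H)‖ * ‖T v‖) := by
    refine (Complex.re_le_norm _).trans ((norm_add_le _ _).trans ?_)
    simp only [norm_mul, RCLike.norm_conj, hl, hgn, one_mul]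
    have i1 : ‖(inner ℂ (z : H) (T v) : ℂ)‖ ≤ 3 * ‖T v‖ :=
      (norm_inner_le_norm _ _).trans (by gcongr)
    have i2 : ‖(inner ℂ (v : H) (T v) : ℂ)‖ ≤ ‖(v : H)‖ * ‖T v‖ := norm_inner_le_norm _ _
    rw [sq]
    gcongr
  have b2 : ‖((z + g • v : T.domain) : H)‖ ≤ 3 + R * ‖(v : H)‖ := by
    rw [Submodule.coe_add, Submodule.coe_smul]
    refine (norm_add_le _ _).trans ?_
    rw [norm_smul, hgn]
    gcongr
  have b3 : C * ‖((z + g • v : T.domain) : H)‖ ^ 2 ≤ C * (3 + R * ‖(v : H)‖) ^ 2 := by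
    gcongr
  linarith

theorem main_bound (T : H →ₗ.[ℂ] H) (y u : T.domain) (hy : ‖(y : H)‖ = 1) (hu : ‖(u : H)‖ = 1)
    (hyu : inner ℂ (y : H) (u : H) = (0 : ℂ)) (δ : ℝ) (hδ : 0 < δ)
    (l₁ l₂ : ℂ) (hl₁ : ‖l₁‖ = 1) (hl₂ : ‖l₂‖ = 1) (C₁ C₂ : ℝ) (hC₁ : 0 ≤ C₁) (hC₂ : 0 ≤ C₂)
    (h₁ : ∀ x : T.domain, inner ℂ (y : H) (x : H) = (0 : ℂ) →
        -C₁ * ‖(x : H)‖ ^ 2 ≤ (l₁ * inner ℂ (x : H) (T x)).re)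
    (h₂ : ∀ x : T.domain, inner ℂ ((y : H) + (δ : ℂ) • (u : H)) (x : H) = (0 : ℂ) →
        -C₂ * ‖(x : H)‖ ^ 2 ≤ (l₂ * inner ℂ (x : H) (T x)).re) :
    ∃ K : ℝ, ∀ x : T.domain, ‖(x : H)‖ = 1 →
      -K ≤ ((2 * l₁ + l₂) * inner ℂ (x : H) (T x)).re := by
  have huy : inner ℂ (u : H) (y : H) = (0 : ℂ) := by rw [← inner_conj_symm, hyu]; simp
  have hyy : inner ℂ (y : H) (y : H) = (1 : ℂ) := by
    rw [inner_self_eq_norm_sq_to_K, hy]; simp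
  have huu : inner ℂ (u : H) (u : H) = (1 : ℂ) := by
    rw [inner_self_eq_norm_sq_to_K, hu]; simp
  set v : T.domain := (δ : ℂ) • y - u with hv
  set R : ℝ := 3 * (1 + δ⁻¹) with hR
  obtain ⟨K₁, hK₁⟩ := lemA T l₁ hl₁ u C₁ R hC₁
  obtain ⟨K₂, hK₂⟩ := lemA T l₂ hl₂ v C₂ R hC₂
  set N : ℝ := ‖T y‖ + ‖T u‖ with hN
  refine ⟨K₁ + K₂ + C₁ * 9 + 3 * (3 * N + 2 * N), fun x hx => ?_⟩
  set c : ℂ := inner ℂ (y : H) (x : H) with hc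
  set d : ℂ := inner ℂ (u : H) (x : H) with hd
  have hcn : ‖c‖ ≤ 1 := by
    have := norm_inner_le_norm (𝕜 := ℂ) (y : H) (x : H)
    rwa [hy, hx, one_mul] at this
  have hdn : ‖d‖ ≤ 1 := by
    have := norm_inner_le_norm (𝕜 := ℂ) (u : H) (x : H)
    rwa [hu, hx, one_mul] at this
  set s : T.domain := c • y + d • u with hs
  set z : T.domain := x - s with hz
  have hxzs : x = z + s := by rw [hz]; abel
  have hsn : ‖(s : H)‖ ≤ 2 := by
    rw [hs, Submodule.coe_add, Submodule.coe_smul, Submodule.coe_smul]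
    refine (norm_add_le _ _).trans ?_
    rw [norm_smul, norm_smul, hy, hu]; linarith
  have hTs : ‖T s‖ ≤ N := by
    rw [hs, LinearPMap.map_add, LinearPMap.map_smul, LinearPMap.map_smul]
    refine (norm_add_le _ _).trans ?_
    rw [norm_smul, norm_smul]
    exact add_le_add (mul_le_of_le_one_left (norm_nonneg _) hcn)
      (mul_le_of_le_one_left (norm_nonneg _) hdn)
  have hzn : ‖(z : H)‖ ≤ 3 := by
    rw [hz, Submodule.coe_sub]
    refine (norm_sub_le _ _).trans ?_
    linarith
  have hyz : inner ℂ (y : H) (z : H) = (0 : ℂ) := by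
    simp [hz, hs, inner_sub_right, inner_add_right, inner_smul_right, hy, hyu, ← hc]
  have huz : inner ℂ (u : H) (z : H) = (0 : ℂ) := by
    simp [hz, hs, inner_sub_right, inner_add_right, inner_smul_right, hu, huy, ← hd]
  have hδ' : (δ : ℂ) ≠ 0 := by exact_mod_cast hδ.ne'
  set β : ℂ := c * (δ : ℂ)⁻¹ with hβ
  set α : ℂ := d + β with hα
  have hsv : s = α • u + β • v := by
    rw [hs, hv, smul_sub, smul_smul, hβ, mul_assoc, inv_mul_cancel₀ hδ', mul_one, hα, add_smul]
    abel
  have hβn : ‖β‖ ≤ δ⁻¹ := by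
    rw [hβ, norm_mul, norm_inv, Complex.norm_real, Real.norm_eq_abs, abs_of_pos hδ]
    exact mul_le_of_le_one_left (by positivity) hcn
  have hαn : ‖α‖ ≤ 1 + δ⁻¹ := (norm_add_le _ _).trans (add_le_add hdn hβn)
  have q1 := hK₁ z hzn (fun g => h₁ _ (by
    simp [inner_add_right, inner_smul_right, hyz, hyu])) (3 * ‖α‖) (by positivity)
    (by rw [hR]; linarith)
  have q2 := hK₂ z hzn (fun g => h₂ _ (by
    simp [hv, inner_add_right, inner_add_left, inner_sub_right, inner_smul_right, inner_smul_left,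
      hyz, hyu, huz, hu, hy, huy])) (3 * ‖β‖) (by positivity)
    (by rw [hR]; linarith)
  have q3 : -C₁ * 9 ≤ (l₁ * inner ℂ (z : H) (T z)).re := by
    refine le_trans ?_ (h₁ z hyz)
    have : ‖(z : H)‖ ^ 2 ≤ 9 := by nlinarith [norm_nonneg (z : H)]
    nlinarith
  set μ : ℂ := 2 * l₁ + l₂ with hμ
  have hμn : ‖μ‖ ≤ 3 := by
    refine (norm_add_le _ _).trans ?_
    rw [norm_mul, hl₁, hl₂]; norm_num
  have hexp : μ * inner ℂ (x : H) (T x) = l₁ * inner ℂ (z : H) (T z) + l₁ * inner ℂ (z : H) (T z)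
      + l₂ * inner ℂ (z : H) (T z) - (-(μ * (inner ℂ (s : H) (T z) + inner ℂ (z : H) (T s)
        + inner ℂ (s : H) (T s)))) := by
    rw [hxzs]
    simp only [LinearPMap.map_add, Submodule.coe_add, inner_add_left, inner_add_right, hμ]
    ring
  have r1 : ‖(inner ℂ (s : H) (T z) : ℂ)‖ ≤ ‖α‖ * ‖(inner ℂ (u : H) (T z) : ℂ)‖ +
      ‖β‖ * ‖(inner ℂ (v : H) (T z) : ℂ)‖ := by
    rw [hsv, Submodule.coe_add, Submodule.coe_smul, Submodule.coe_smul, inner_add_left,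
      inner_smul_left, inner_smul_left]
    refine (norm_add_le _ _).trans ?_
    rw [norm_mul, norm_mul, RCLike.norm_conj, RCLike.norm_conj]
  have r2 : ‖(inner ℂ (z : H) (T s) : ℂ)‖ ≤ 3 * N :=
    (norm_inner_le_norm _ _).trans (by gcongr)
  have r3 : ‖(inner ℂ (s : H) (T s) : ℂ)‖ ≤ 2 * N :=
    (norm_inner_le_norm _ _).trans (by gcongr)
  have r4 : (-(μ * (inner ℂ (s : H) (T z) + inner ℂ (z : H) (T s)
        + inner ℂ (s : H) (T s)))).re ≤ 3 * ((‖α‖ * ‖(inner ℂ (u : H) (T z) : ℂ)‖ +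
      ‖β‖ * ‖(inner ℂ (v : H) (T z) : ℂ)‖) + 3 * N + 2 * N) := by
    refine (Complex.re_le_norm _).trans ?_
    rw [norm_neg, norm_mul]
    have : ‖(inner ℂ (s : H) (T z) + inner ℂ (z : H) (T s) + inner ℂ (s : H) (T s) : ℂ)‖ ≤
      (‖α‖ * ‖(inner ℂ (u : H) (T z) : ℂ)‖ +
      ‖β‖ * ‖(inner ℂ (v : H) (T z) : ℂ)‖) + 3 * N + 2 * N :=
      norm_add₃_le.trans (add_le_add (add_le_add r1 r2) r3)
    gcongr
  rw [hexp, Complex.sub_re, Complex.add_re, Complex.add_re]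
  linarith

/-- Lemma 2.8 ii): if `W(T) = ℂ` and `y ∈ dom T`, `‖y‖ = 1`, with
`{y}^⊥ ∩ dom T ≠ {0}`, then for every `ε > 0` there is a unit vector
`w ∈ dom T` such that `W(T|_{{w}^⊥ ∩ dom T}) = ℂ` and `|⟨Tw,w⟩ - ⟨Ty,y⟩| < ε`. -/
theorem exists_unit_vector_numRange_restrict_univ
    [TopologicalSpace.SeparableSpace H] (hinf : ¬FiniteDimensional ℂ H)
    (T : H →ₗ.[ℂ] H) (hW : numRange T = Set.univ)
    (y : T.domain) (hy : ‖(y : H)‖ = 1)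
    (hperp : ∃ x : T.domain, (x : H) ≠ 0 ∧ (inner ℂ ((x : H)) ((y : H)) : ℂ) = 0) :
    ∀ ε : ℝ, 0 < ε → ∃ w : T.domain, ‖(w : H)‖ = 1 ∧
      numRange (T.domRestrict (ℂ ∙ (w : H))ᗮ) = Set.univ ∧
      ‖(inner ℂ ((w : H)) (T w) : ℂ) - (inner ℂ ((y : H)) (T y) : ℂ)‖ < ε := by
  intro ε hε
  obtain ⟨u₀, hu₀, hu₀y⟩ := hperp
  by_cases hgood : numRange (T.domRestrict (ℂ ∙ (y : H))ᗮ) = Set.univ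
  · exact ⟨y, hy, hgood, by simpa using hε⟩
  have hn₀ := norm_ne_zero_iff.mpr hu₀
  obtain ⟨u, hu, hyu⟩ : ∃ u : T.domain, ‖(u : H)‖ = 1 ∧ inner ℂ (y : H) (u : H) = (0 : ℂ) := by
    refine ⟨((‖(u₀ : H)‖ : ℝ) : ℂ)⁻¹ • u₀, ?_, ?_⟩
    · rw [Submodule.coe_smul, norm_smul]; simp [hn₀]
    · rw [Submodule.coe_smul, inner_smul_right, ← inner_conj_symm, hu₀y]; simp
  have hne : ∀ δ : ℝ, (y : H) + (δ : ℂ) • (u : H) ≠ 0 := by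
    intro δ h
    have := congrArg (fun t => inner ℂ (y : H) t) h
    simp only [inner_add_right, inner_smul_right, hyu, inner_self_eq_norm_sq_to_K, hy] at this
    simp at this
  -- choose a small `δ`
  have hcont : ContinuousAt (fun δ : ℝ => ‖((‖(y : H) + (δ : ℂ) • (u : H)‖ : ℝ) : ℂ)⁻¹ *
      (((‖(y : H) + (δ : ℂ) • (u : H)‖ : ℝ) : ℂ)⁻¹ *
      inner ℂ ((y : H) + (δ : ℂ) • (u : H)) (T y + (δ : ℂ) • T u)) - inner ℂ (y : H) (T y)‖) 0 := by
    have h1 : ContinuousAt (fun δ : ℝ => ((‖(y : H) + (δ : ℂ) • (u : H)‖ : ℝ) : ℂ)⁻¹) 0 := by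
      apply ContinuousAt.inv₀
      · fun_prop
      · exact_mod_cast norm_ne_zero_iff.mpr (hne 0)
    have h2 : ContinuousAt (fun δ : ℝ =>
      (inner ℂ ((y : H) + (δ : ℂ) • (u : H)) (T y + (δ : ℂ) • T u) : ℂ)) 0 := by fun_prop
    exact ((h1.mul (h1.mul h2)).sub continuousAt_const).norm
  have hev := hcont.eventually_lt_const (u := ε) (by simpa [hy] using hε)
  obtain ⟨δ, hδε, hδ⟩ := ((hev.filter_mono nhdsWithin_le_nhds).and
    (self_mem_nhdsWithin : Set.Ioi (0 : ℝ) ∈ nhdsWithin 0 (Set.Ioi 0))).exists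
  have hδ : 0 < δ := hδ
  set w₀ : T.domain := y + (δ : ℂ) • u with hw₀
  have hw₀c : (w₀ : H) = (y : H) + (δ : ℂ) • (u : H) := by simp [hw₀]
  have hwn : ‖(w₀ : H)‖ ≠ 0 := by rw [hw₀c]; exact norm_ne_zero_iff.mpr (hne δ)
  have hwnc : ((‖(w₀ : H)‖ : ℝ) : ℂ) ≠ 0 := by exact_mod_cast hwn
  refine ⟨((‖(w₀ : H)‖ : ℝ) : ℂ)⁻¹ • w₀, ?_, ?_, ?_⟩
  · rw [Submodule.coe_smul, norm_smul]; simp [hwn]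
  · by_contra hbad
    obtain ⟨l₁, hl₁, C₁, hC₁, h₁⟩ := half_plane_restrict T _ hgood
    obtain ⟨l₂, hl₂, C₂, hC₂, h₂⟩ := half_plane_restrict T _ hbad
    obtain ⟨K, hK⟩ := main_bound T y u hy hu hyu δ hδ l₁ l₂ hl₁ hl₂ C₁ C₂ hC₁ hC₂ h₁
      (fun x hx => h₂ x (by
        rw [Submodule.coe_smul, inner_smul_left, hw₀c, hx, mul_zero]))
    have hμ : 2 * l₁ + l₂ ≠ 0 := by
      intro h
      have : ‖2 * l₁‖ = ‖l₂‖ := by rw [eq_neg_of_add_eq_zero_left h, norm_neg]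
      rw [norm_mul, hl₁, hl₂] at this
      norm_num at this
    obtain ⟨x, hx, hxz⟩ : ((-(K + 1) : ℝ) : ℂ) / (2 * l₁ + l₂) ∈ numRange T := by
      rw [hW]; trivial
    have := hK x hx
    rw [hxz, mul_div_cancel₀ _ hμ, Complex.ofReal_re] at this
    linarith
  · rw [LinearPMap.map_smul, Submodule.coe_smul, inner_smul_left, inner_smul_right, map_inv₀,
      Complex.conj_ofReal]
    have hT : T w₀ = T y + (δ : ℂ) • T u := by rw [hw₀, LinearPMap.map_add, LinearPMap.map_smul]
    rw [hT, hw₀c]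
    exact hδε
end
end

section
/- For every linear operator T in H the following inclusions and equalities hold: W_{e1}(T) ⊆ W_{e4}(T) ⊆ W_{e2}(T) = W_{e3}(T) = W_e(T). -/
open Filter Topology

noncomputable section

variable {H : Type*} [NormedAddCommGroup H] [InnerProductSpace ℂ H] [CompleteSpace H]

/-- The sum `T + K` of a linear operator `T` in `H` and a bounded operator `K` on `H`,
with domain `dom T`. -/
def pmapAddCLM (T : H →ₗ.[ℂ] H) (K : H →L[ℂ] H) : H →ₗ.[ℂ] H :=
  { domain := T.domain
    toFun := T.toFun + (K : H →ₗ[ℂ] H).comp T.domain.subtype }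

/-- `W_{e1}(T)`: intersection over all finite-dimensional subspaces `V ⊆ H` of the
closure of `W(T|_{V^⊥ ∩ dom T})`. -/
def We1 (T : H →ₗ.[ℂ] H) : Set ℂ :=
  ⋂ (V : Submodule ℂ H) (_ : FiniteDimensional ℂ V),
    closure (numRange (T.domRestrict Vᗮ))

/-- `W_{e2}(T)`: intersection over all bounded finite-rank operators `K`
of the closure of `W(T + K)`. -/
def We2 (T : H →ₗ.[ℂ] H) : Set ℂ :=
  ⋂ (K : H →L[ℂ] H) (_ : FiniteDimensional ℂ (LinearMap.range (K : H →ₗ[ℂ] H))),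
    closure (numRange (pmapAddCLM T K))

/-- `W_{e3}(T)`: intersection over all compact bounded operators `K`
of the closure of `W(T + K)`. -/
def We3 (T : H →ₗ.[ℂ] H) : Set ℂ :=
  ⋂ (K : H →L[ℂ] H) (_ : IsCompactOperator fun x : H => K x),
    closure (numRange (pmapAddCLM T K))

/-- `W_{e4}(T)`: the set of limits of `⟨T e_n, e_n⟩` along orthonormal sequences
`(e_n) ⊆ dom T`. -/
def We4 (T : H →ₗ.[ℂ] H) : Set ℂ :=
  {z | ∃ e : ℕ → T.domain, Orthonormal ℂ (fun n => ((e n : H))) ∧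
    Tendsto (fun n => (inner ℂ ((e n : H)) (T (e n)) : ℂ)) atTop (nhds z)}

lemma aux_We1_sub_We4 (T : H →ₗ.[ℂ] H) : We1 T ⊆ We4 T := by
  intro z hz
  have key : ∀ (s : Finset (ℕ × T.domain)),
      (∀ p ∈ s, ‖(p.2 : H)‖ = 1 ∧ dist (inner ℂ (p.2 : H) (T p.2) : ℂ) z < 1 / ((p.1 : ℝ) + 1)) →
      ∃ q : ℕ × T.domain, (‖(q.2 : H)‖ = 1 ∧
        dist (inner ℂ (q.2 : H) (T q.2) : ℂ) z < 1 / ((q.1 : ℝ) + 1)) ∧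
        ∀ p ∈ s, (inner ℂ (p.2 : H) (q.2 : H) : ℂ) = 0 ∧ p.1 < q.1 := by
    intro s _
    classical
    let A : Set H := ((s.image fun p => (p.2 : H) : Finset H) : Set H)
    have hfin : FiniteDimensional ℂ (Submodule.span ℂ A) :=
      FiniteDimensional.span_finset ℂ _
    have h1 : z ∈ closure (numRange (T.domRestrict (Submodule.span ℂ A)ᗮ)) := by
      have := hz
      simp only [We1, Set.mem_iInter] at this
      exact this _ hfin
    let k := s.sup Prod.fst + 1
    obtain ⟨w, ⟨x, hx1, hx2⟩, hw⟩ := Metric.mem_closure_iff.1 h1 (1 / ((k : ℝ) + 1)) (by positivity)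
    have hxm : (x : H) ∈ (Submodule.span ℂ A)ᗮ ⊓ T.domain := x.2
    let y : T.domain := ⟨x, hxm.2⟩
    have hT : (T.domRestrict (Submodule.span ℂ A)ᗮ) x = T y :=
      LinearPMap.domRestrict_apply (f := T) (y := y) rfl
    refine ⟨(k, y), ⟨hx1, ?_⟩, ?_⟩
    · rw [hT] at hx2
      change dist (inner ℂ (x : H) (T y)) z < _
      rw [hx2, dist_comm]; exact hw
    · intro p hp
      constructor
      · refine (Submodule.mem_orthogonal _ _).1 hxm.1 _ (Submodule.subset_span ?_)
        simp only [A, Finset.coe_image]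
        exact ⟨p, hp, rfl⟩
      · exact Nat.lt_succ_of_le (Finset.le_sup (f := Prod.fst) hp)
  obtain ⟨f, hf1, hf2⟩ := exists_seq_of_forall_finset_exists _ _ key
  have hmono : StrictMono fun n => (f n).1 := fun m n h => (hf2 m n h).2
  refine ⟨fun n => (f n).2, ⟨fun n => (hf1 n).1, ?_⟩, ?_⟩
  · intro m n hmn
    rcases lt_or_gt_of_ne hmn with h | h
    · exact (hf2 m n h).1
    · exact inner_eq_zero_symm.1 (hf2 n m h).1
  · rw [tendsto_iff_dist_tendsto_zero]
    refine squeeze_zero (fun _ => dist_nonneg) (fun n => (hf1 n).2.le) ?_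
    exact (tendsto_one_div_add_atTop_nhds_zero_nat (𝕜 := ℝ)).comp hmono.tendsto_atTop

lemma aux_We4_sub_ess (T : H →ₗ.[ℂ] H) : We4 T ⊆ essNumRange T := by
  rintro z ⟨e, he, hz⟩
  refine ⟨e, he.1, fun y => ?_, hz⟩
  have h := (he.inner_products_summable (x := y)).tendsto_atTop_zero
  rw [tendsto_zero_iff_norm_tendsto_zero]
  have h2 := h.sqrt
  simpa [Real.sqrt_sq] using h2

lemma aux_compact {K : H →L[ℂ] H} (hK : IsCompactOperator fun x : H => K x)
    {x : ℕ → H} (hx : ∀ n, ‖x n‖ = 1) (hw : WeakNull x) :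
    Tendsto (fun n => K (x n)) atTop (𝓝 0) := by
  refine tendsto_of_subseq_tendsto fun ns hns => ?_
  have hc : IsCompact (closure (K '' Metric.closedBall 0 1)) :=
    IsCompactOperator.isCompact_closure_image_closedBall (f := (K : H →ₗ[ℂ] H)) hK 1
  obtain ⟨a, _, φ, hφ, ha⟩ := hc.tendsto_subseq (x := fun n => K (x (ns n)))
    (fun n => subset_closure ⟨x (ns n), by simp [hx], rfl⟩)
  refine ⟨φ, ?_⟩
  have h1 : Tendsto (fun n => (inner ℂ (K (x (ns (φ n)))) a : ℂ)) atTop (𝓝 (inner ℂ a a)) :=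
    ha.inner tendsto_const_nhds
  have h2 : Tendsto (fun n => (inner ℂ (K (x (ns (φ n)))) a : ℂ)) atTop (𝓝 0) := by
    have := ((hw (ContinuousLinearMap.adjoint K a)).comp hns).comp hφ.tendsto_atTop
    simpa [Function.comp_def, ContinuousLinearMap.adjoint_inner_right] using this
  have : a = 0 := inner_self_eq_zero.1 (tendsto_nhds_unique h1 h2)
  rw [this] at ha
  exact ha

lemma aux_add_apply (T : H →ₗ.[ℂ] H) (K : H →L[ℂ] H) (x : T.domain) :
    (pmapAddCLM T K) x = T x + K x := rfl

lemma aux_ess_sub_We3 (T : H →ₗ.[ℂ] H) : essNumRange T ⊆ We3 T := by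
  rintro z ⟨x, hx, hw, hz⟩
  simp only [We3, Set.mem_iInter]
  intro K hK
  have h1 := aux_compact hK hx hw
  have h2 : Tendsto (fun n => (inner ℂ (x n : H) (K (x n)) : ℂ)) atTop (𝓝 0) := by
    refine squeeze_zero_norm (fun n => ?_) (tendsto_zero_iff_norm_tendsto_zero.1 h1)
    simpa [hx] using norm_inner_le_norm (𝕜 := ℂ) (x n : H) (K (x n))
  have h3 := hz.add h2
  rw [add_zero] at h3
  refine mem_closure_of_tendsto h3 (Eventually.of_forall fun n => ⟨x n, hx n, ?_⟩)
  erw [aux_add_apply, inner_add_right]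

lemma aux_We3_sub_We2 (T : H →ₗ.[ℂ] H) : We3 T ⊆ We2 T := by
  intro z hz
  simp only [We3, We2, Set.mem_iInter] at hz ⊢
  intro K hK
  refine hz K ?_
  have h1 : IsCompactOperator (K.codRestrict (LinearMap.range (K : H →ₗ[ℂ] H)) (fun x => ⟨x, rfl⟩)) := by
    have : ProperSpace (LinearMap.range (K : H →ₗ[ℂ] H)) := FiniteDimensional.proper ℂ _
    exact isCompactOperator_of_locallyCompactSpace_dom
      (K.codRestrict (LinearMap.range (K : H →ₗ[ℂ] H)) (fun x => ⟨x, rfl⟩))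
  exact h1.clm_comp (LinearMap.range (K : H →ₗ[ℂ] H)).subtypeL

lemma aux_phase (p q r : ℂ) : ∃ θ : ℂ, ‖θ‖ = 1 ∧ (θ * p + (starRingEnd ℂ θ) * q).im = 0 ∧
    0 ≤ (θ * r).re := by
  obtain ⟨θ, h1, h2⟩ : ∃ θ : ℂ, ‖θ‖ = 1 ∧ (θ * p + (starRingEnd ℂ θ) * q).im = 0 := by
    by_cases h : p - starRingEnd ℂ q = 0
    · refine ⟨1, by simp, ?_⟩
      rw [sub_eq_zero.1 h]
      simp
    · set d := p - starRingEnd ℂ q with hd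
      have hn : ‖d‖ ≠ 0 := norm_ne_zero_iff.2 h
      refine ⟨(starRingEnd ℂ d) / ‖d‖, by simp [hn], ?_⟩
      have e : starRingEnd ℂ d / (‖d‖ : ℂ) = (((‖d‖)⁻¹ : ℝ) : ℂ) * starRingEnd ℂ d := by
        push_cast; ring
      have : p = d + starRingEnd ℂ q := by rw [hd]; ring
      rw [e, this]
      simp
      ring
  rcases le_total 0 (θ * r).re with h | h
  · exact ⟨θ, h1, h2, h⟩
  · refine ⟨-θ, by simpa using h1, ?_, by simpa using h⟩
    have : (-θ) * p + (starRingEnd ℂ (-θ)) * q = -(θ * p + (starRingEnd ℂ θ) * q) := by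
      simp; ring
    rw [this, Complex.neg_im, h2, neg_zero]

/-- quantitative Toeplitz-Hausdorff -/
lemma aux_segment (T : H →ₗ.[ℂ] H) (P : H →L[ℂ] H) {δ : ℝ} (x y : T.domain)
    (hx : ‖(x : H)‖ = 1) (hy : ‖(y : H)‖ = 1) (hPx : ‖P x‖ ≤ δ) (hPy : ‖P y‖ ≤ δ) {z : ℂ}
    (hz : z ∈ segment ℝ (inner ℂ (x : H) (T x) : ℂ) (inner ℂ (y : H) (T y) : ℂ)) :
    ∃ v : T.domain, ‖(v : H)‖ = 1 ∧ ‖P v‖ ≤ 2 * δ ∧ (inner ℂ (v : H) (T v) : ℂ) = z := by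
  have hδ : 0 ≤ δ := (norm_nonneg _).trans hPx
  set a : ℂ := inner ℂ (x : H) (T x) with ha
  set b : ℂ := inner ℂ (y : H) (T y) with hb
  by_cases hab : a = b
  · rw [← hab, segment_same] at hz
    exact ⟨x, hx, by linarith, by rw [hz.out]⟩
  have hc : b - a ≠ 0 := sub_ne_zero.2 (Ne.symm hab)
  rw [segment_eq_image'] at hz
  obtain ⟨τ, hτ, rfl⟩ := hz
  set p : ℂ := ((inner ℂ (x : H) (T y) : ℂ) - a * inner ℂ (x : H) (y : H)) / (b - a) with hp
  set q : ℂ := ((inner ℂ (y : H) (T x) : ℂ) - a * inner ℂ (y : H) (x : H)) / (b - a) with hq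
  obtain ⟨θ, h1, h2, h3⟩ := aux_phase p q (inner ℂ (x : H) (y : H))
  have hθ : starRingEnd ℂ θ * θ = 1 := by
    rw [mul_comm, Complex.mul_conj, Complex.normSq_eq_norm_sq, h1]; simp
  set r : ℝ := (θ * p + (starRingEnd ℂ θ) * q).re with hr
  have hr' : θ * p + (starRingEnd ℂ θ) * q = (r : ℂ) := by
    apply Complex.ext <;> simp [hr, h2]
  set ρ : ℝ := (θ * (inner ℂ (x : H) (y : H) : ℂ)).re with hρ
  let v : ℝ → T.domain := fun s => ((1 - s : ℝ) : ℂ) • x + ((s : ℂ) * θ) • y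
  let n : ℝ → ℝ := fun s => (1 - s) ^ 2 + s ^ 2 + 2 * s * (1 - s) * ρ
  have hxx : (inner ℂ (x : H) (x : H) : ℂ) = 1 := by
    rw [inner_self_eq_norm_sq_to_K, hx]; simp
  have hyy : (inner ℂ (y : H) (y : H) : ℂ) = 1 := by
    rw [inner_self_eq_norm_sq_to_K, hy]; simp
  have hyx : (inner ℂ (y : H) (x : H) : ℂ) = starRingEnd ℂ (inner ℂ (x : H) (y : H)) :=
    (inner_conj_symm _ _).symm
  have hρ2 : θ * (inner ℂ (x : H) (y : H) : ℂ) + starRingEnd ℂ θ * (inner ℂ (y : H) (x : H) : ℂ)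
      = 2 * (ρ : ℂ) := by
    rw [hyx, ← map_mul, Complex.add_conj, hρ]; simp
  have hvv : ∀ s, (inner ℂ (v s : H) (v s : H) : ℂ) = (n s : ℂ) := by
    intro s
    simp only [v, n, Submodule.coe_add, Submodule.coe_smul, inner_add_left, inner_add_right,
      inner_smul_left, inner_smul_right, hxx, hyy, map_mul, Complex.conj_ofReal]
    push_cast
    linear_combination (s : ℂ) ^ 2 * hθ + (s : ℂ) * (1 - s) * hρ2
  have hnorm : ∀ s, ‖(v s : H)‖ ^ 2 = n s := by
    intro s
    have : ((‖(v s : H)‖ ^ 2 : ℝ) : ℂ) = (n s : ℂ) := by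
      rw [← hvv s, inner_self_eq_norm_sq_to_K]; simp
    exact Complex.ofReal_injective this
  have hpm : p * (b - a) = (inner ℂ (x : H) (T y) : ℂ) - a * inner ℂ (x : H) (y : H) :=
    div_mul_cancel₀ _ hc
  have hqm : q * (b - a) = (inner ℂ (y : H) (T x) : ℂ) - a * inner ℂ (y : H) (x : H) :=
    div_mul_cancel₀ _ hc
  have hTv : ∀ s, (inner ℂ (v s : H) (T (v s)) : ℂ)
      = a * (n s : ℂ) + (b - a) * ((s ^ 2 + s * (1 - s) * r : ℝ) : ℂ) := by
    intro s
    rw [← hvv s]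
    simp only [v, LinearPMap.map_add, LinearPMap.map_smul, Submodule.coe_add, Submodule.coe_smul,
      inner_add_left, inner_add_right,
      inner_smul_left, inner_smul_right, hxx, hyy, map_mul, Complex.conj_ofReal, ← ha, ← hb]
    push_cast
    linear_combination (s : ℂ) ^ 2 * (b - a) * hθ + (s : ℂ) * (1 - s) * (b - a) * hr'
      - (s : ℂ) * (1 - s) * θ * hpm - (s : ℂ) * (1 - s) * (starRingEnd ℂ θ) * hqm
  have hnpos : ∀ s ∈ Set.Icc (0 : ℝ) 1, 1 / 4 ≤ n s := by
    intro s hs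
    have : 0 ≤ s * (1 - s) * ρ := mul_nonneg (mul_nonneg hs.1 (by linarith [hs.2])) h3
    simp only [n]
    nlinarith [sq_nonneg (2 * s - 1)]
  have hcont : ContinuousOn (fun s => (s ^ 2 + s * (1 - s) * r) / n s) (Set.Icc (0 : ℝ) 1) := by
    refine ContinuousOn.div (by fun_prop) (by simp only [n]; fun_prop) fun s hs => ?_
    have := hnpos s hs
    positivity
  obtain ⟨s, hs, hsτ⟩ : ∃ s ∈ Set.Icc (0 : ℝ) 1, (s ^ 2 + s * (1 - s) * r) / n s = τ := by
    have := intermediate_value_Icc (zero_le_one (α := ℝ)) hcont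
    refine this ?_
    simpa [n] using hτ
  have hn4 := hnpos s hs
  have hn0 : n s ≠ 0 := by positivity
  have hvn : 1 / 2 ≤ ‖(v s : H)‖ := by
    have := hnorm s
    nlinarith [norm_nonneg (v s : H)]
  have hv0 : ‖(v s : H)‖ ≠ 0 := by positivity
  refine ⟨((‖(v s : H)‖⁻¹ : ℝ) : ℂ) • v s, ?_, ?_, ?_⟩
  · rw [Submodule.coe_smul, norm_smul]
    simp [hv0]
  · rw [Submodule.coe_smul, map_smul, norm_smul]
    have hle : ‖P (v s)‖ ≤ δ := by
      simp only [v, Submodule.coe_add, Submodule.coe_smul, map_add, map_smul]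
      refine (norm_add_le _ _).trans ?_
      rw [norm_smul, norm_smul, norm_mul, h1, Complex.norm_real, Complex.norm_real,
        Real.norm_of_nonneg hs.1, Real.norm_of_nonneg (by linarith [hs.2] : 0 ≤ 1 - s)]
      nlinarith [hs.1, hs.2]
    have hinv : ‖(v s : H)‖⁻¹ ≤ 2 := by
      rw [inv_le_comm₀ (by positivity) (by norm_num)]; linarith
    rw [Complex.norm_real, Real.norm_of_nonneg (by positivity)]
    exact mul_le_mul hinv hle (norm_nonneg _) (by norm_num)
  · rw [Submodule.coe_smul, LinearPMap.map_smul, inner_smul_left, inner_smul_right, hTv,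
      Complex.conj_ofReal, ← hsτ]
    have e : ((‖(v s : H)‖⁻¹ : ℝ) : ℂ) * ((‖(v s : H)‖⁻¹ : ℝ) : ℂ) = ((n s)⁻¹ : ℝ) := by
      rw [← hnorm s, ← Complex.ofReal_mul]; congr 1; rw [inv_pow .. |>.symm]; ring
    rw [← mul_assoc, e]
    simp only [Complex.real_smul]
    have hn0' : (n s : ℂ) ≠ 0 := by exact_mod_cast hn0
    push_cast
    field_simp

lemma aux_hull (T : H →ₗ.[ℂ] H) (P : H →L[ℂ] H) {δ : ℝ} {z : ℂ}
    (hz : z ∈ convexHull ℝ {w : ℂ | ∃ x : T.domain, ‖(x : H)‖ = 1 ∧ ‖P x‖ ≤ δ ∧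
      (inner ℂ (x : H) (T x) : ℂ) = w}) :
    ∃ v : T.domain, ‖(v : H)‖ = 1 ∧ ‖P v‖ ≤ 4 * δ ∧ (inner ℂ (v : H) (T v) : ℂ) = z := by
  rw [convexHull_eq_union] at hz
  simp only [Set.mem_iUnion] at hz
  obtain ⟨t, hts, hti, hzt⟩ := hz
  have hcard : t.card ≤ 3 := by
    have := hti.card_le_finrank_succ
    have h2 : Module.finrank ℝ (vectorSpan ℝ (Set.range ((↑) : t → ℂ))) ≤ 2 :=
      (Submodule.finrank_le _).trans Complex.finrank_real_complex.le
    rw [Fintype.card_coe] at this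
    omega
  -- any point of the hull is in a triangle
  obtain ⟨a, b, c, ha, hb, hc, hzabc⟩ : ∃ a b c : ℂ, a ∈ t ∧ b ∈ t ∧ c ∈ t ∧
      z ∈ convexHull ℝ {a, b, c} := by
    interval_cases h : t.card
    · simp [Finset.card_eq_zero.1 h] at hzt
    · obtain ⟨a, rfl⟩ := Finset.card_eq_one.1 h
      exact ⟨a, a, a, by simp, by simp, by simp, by simpa using hzt⟩
    · obtain ⟨a, b, _, rfl⟩ := Finset.card_eq_two.1 h
      exact ⟨a, b, b, by simp, by simp, by simp, by simpa using hzt⟩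
    · obtain ⟨a, b, c, _, _, _, rfl⟩ := Finset.card_eq_three.1 h
      exact ⟨a, b, c, by simp, by simp, by simp, by simpa using hzt⟩
  rw [convexHull_insert (by simp), convexHull_pair] at hzabc
  simp only [convexJoin_singleton_left, Set.mem_iUnion] at hzabc
  obtain ⟨d, hd, hzd⟩ := hzabc
  obtain ⟨xa, ha1, ha2, rfl⟩ := hts ha
  obtain ⟨xb, hb1, hb2, rfl⟩ := hts hb
  obtain ⟨xc, hc1, hc2, rfl⟩ := hts hc
  obtain ⟨y, hy1, hy2, rfl⟩ := aux_segment T P xb xc hb1 hc1 hb2 hc2 hd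
  have hδ : 0 ≤ δ := (norm_nonneg _).trans ha2
  obtain ⟨v, hv1, hv2, hv3⟩ := aux_segment T P xa y ha1 hy1 (ha2.trans (by linarith)) hy2 hzd
  exact ⟨v, hv1, by linarith, hv3⟩

/-- If the numerical values on the cone `‖P x‖ ≤ δ ‖x‖` lie in a half plane, then all numerical
values lie in a (larger) parallel half plane. -/
lemma aux_bounded_below (T : H →ₗ.[ℂ] H) (P : H →L[ℂ] H)
    (hPfin : FiniteDimensional ℂ (LinearMap.range (P : H →ₗ[ℂ] H))) (hP : ∀ x, ‖P x‖ ≤ ‖x‖)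
    {δ : ℝ} (hδ : 0 < δ) (f : ℂ →L[ℝ] ℝ) (u : ℝ)
    (h : ∀ x : T.domain, ‖(x : H)‖ = 1 → ‖P x‖ ≤ δ → u ≤ f (inner ℂ (x : H) (T x))) :
    ∃ M : ℝ, ∀ x : T.domain, ‖(x : H)‖ = 1 → -M ≤ f (inner ℂ (x : H) (T x)) := by
  by_cases hw : ∃ w : T.domain, ‖(w : H)‖ = 1 ∧ ‖P w‖ ≤ δ / 2
  · obtain ⟨w, hw1, hw2⟩ := hw
    have hcone : ∀ y : T.domain, ‖P y‖ ≤ δ * ‖(y : H)‖ →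
        u * ‖(y : H)‖ ^ 2 ≤ f (inner ℂ (y : H) (T y)) := by
      intro y hy
      by_cases hy0 : ‖(y : H)‖ = 0
      · have : (y : H) = 0 := norm_eq_zero.1 hy0
        simp [this]
      have hypos : 0 < ‖(y : H)‖ := lt_of_le_of_ne (norm_nonneg _) (Ne.symm hy0)
      have h1 := h (((‖(y : H)‖⁻¹ : ℝ) : ℂ) • y) (by
        rw [Submodule.coe_smul, norm_smul]; simp [hy0]) (by
        rw [Submodule.coe_smul, map_smul, norm_smul, Complex.norm_real,
          Real.norm_of_nonneg (by positivity), inv_mul_le_iff₀ hypos]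
        linarith)
      rw [Submodule.coe_smul, LinearPMap.map_smul, inner_smul_left, inner_smul_right,
        Complex.conj_ofReal, ← Complex.real_smul, ← Complex.real_smul, map_smul, map_smul,
        smul_eq_mul, smul_eq_mul] at h1
      have h2 := mul_le_mul_of_nonneg_right h1 (sq_nonneg ‖(y : H)‖)
      refine h2.trans (le_of_eq ?_)
      field_simp
    set R : ℝ := 2 / δ + 2 with hR
    have hRδ : δ * R = 2 + 2 * δ := by rw [hR]; field_simp
    have hR2 : 2 < R := by rw [hR]; have : 0 < 2 / δ := by positivity
                           linarith
    refine ⟨|u| * (R + 1) ^ 2 + R ^ 2 * f (inner ℂ (w : H) (T w)), fun x hx => ?_⟩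
    have hy : ∀ c : ℂ, ‖c‖ = 1 → -(|u| * (R + 1) ^ 2) ≤
        f (inner ℂ (((R : ℂ) • w + c • x : T.domain) : H) (T ((R : ℂ) • w + c • x))) := by
      intro c hc
      have n1 : ‖((R : ℂ) • (w : H))‖ = R := by
        rw [norm_smul, hw1, Complex.norm_real, Real.norm_of_nonneg (by linarith), mul_one]
      have n2 : ‖c • (x : H)‖ = 1 := by rw [norm_smul, hx, hc, mul_one]
      have hup : ‖(((R : ℂ) • w + c • x : T.domain) : H)‖ ≤ R + 1 := by
        have := norm_add_le ((R : ℂ) • (w : H)) (c • (x : H))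
        rw [n1, n2] at this
        simpa using this
      have hlow : R - 1 ≤ ‖(((R : ℂ) • w + c • x : T.domain) : H)‖ := by
        have := norm_sub_le_norm_add ((R : ℂ) • (w : H)) (c • (x : H))
        rw [n1, n2] at this
        simpa using this
      have hPn : ‖P (((R : ℂ) • w + c • x : T.domain) : H)‖ ≤ R * (δ / 2) + 1 := by
        have e : P (((R : ℂ) • w + c • x : T.domain) : H) = (R : ℂ) • P w + P (c • (x : H)) := by
          simp
        rw [e]
        refine (norm_add_le _ _).trans (add_le_add ?_ ((hP _).trans n2.le))
        rw [norm_smul, Complex.norm_real, Real.norm_of_nonneg (by linarith)]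
        exact mul_le_mul_of_nonneg_left hw2 (by linarith)
      have := hcone ((R : ℂ) • w + c • x) (by nlinarith)
      refine le_trans ?_ this
      have h5 : ‖(((R : ℂ) • w + c • x : T.domain) : H)‖ ^ 2 ≤ (R + 1) ^ 2 :=
        pow_le_pow_left₀ (norm_nonneg _) hup 2
      have h6 := neg_abs_le u
      nlinarith [sq_nonneg ‖(((R : ℂ) • w + c • x : T.domain) : H)‖, abs_nonneg u]
    have hp := hy 1 (by simp)
    have hm := hy (-1) (by simp)
    have hsum : (inner ℂ (((R : ℂ) • w + (1 : ℂ) • x : T.domain) : H)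
          (T ((R : ℂ) • w + (1 : ℂ) • x)) : ℂ)
        + inner ℂ (((R : ℂ) • w + (-1 : ℂ) • x : T.domain) : H) (T ((R : ℂ) • w + (-1 : ℂ) • x))
        = (2 * R ^ 2 : ℝ) • (inner ℂ (w : H) (T w) : ℂ) + (2 : ℝ) • inner ℂ (x : H) (T x) := by
      simp only [LinearPMap.map_add, LinearPMap.map_smul, Submodule.coe_add, Submodule.coe_smul,
        inner_add_left, inner_add_right, inner_smul_left, inner_smul_right, Complex.conj_ofReal,
        Complex.real_smul, map_neg, map_one]
      push_cast
      ring
    have h7 := congrArg f hsum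
    rw [map_add, map_add, map_smul, map_smul, smul_eq_mul, smul_eq_mul] at h7
    linarith
  · push Not at hw
    have hinj : Function.Injective
        ((P : H →ₗ[ℂ] H).rangeRestrict.comp T.domain.subtype) := by
      rw [injective_iff_map_eq_zero]
      intro y hy
      by_contra hy0
      have hypos : 0 < ‖(y : H)‖ := norm_pos_iff.2 (by simpa using hy0)
      have hPy : P (y : H) = 0 := by simpa [Subtype.ext_iff] using hy
      have := hw (((‖(y : H)‖⁻¹ : ℝ) : ℂ) • y) (by
        rw [Submodule.coe_smul, norm_smul]; simp [hypos.ne'])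
      rw [Submodule.coe_smul, map_smul, hPy, smul_zero, norm_zero] at this
      linarith
    have hfd : FiniteDimensional ℂ T.domain := FiniteDimensional.of_injective _ hinj
    let T' : T.domain →L[ℂ] H := LinearMap.toContinuousLinearMap T.toFun
    refine ⟨‖f‖ * ‖T'‖, fun x hx => ?_⟩
    have h1 : ‖f (inner ℂ (x : H) (T x))‖ ≤ ‖f‖ * ‖T'‖ := by
      refine (f.le_opNorm _).trans (mul_le_mul_of_nonneg_left ?_ (norm_nonneg _))
      refine (norm_inner_le_norm _ _).trans ?_
      rw [hx, one_mul]
      have := T'.le_opNorm x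
      rw [Submodule.coe_norm, hx, mul_one] at this
      exact this
    exact (abs_le.1 h1).1

lemma aux_exclude (T : H →ₗ.[ℂ] H) (V : Submodule ℂ H) [FiniteDimensional ℂ V] {δ ε : ℝ}
    (hδ : 0 < δ) (hε : 0 < ε) (z : ℂ)
    (h : ∀ x : T.domain, ‖(x : H)‖ = 1 → ‖V.starProjection x‖ ≤ δ →
      ε ≤ dist (inner ℂ (x : H) (T x) : ℂ) z) : z ∉ We2 T := by
  set P : H →L[ℂ] H := V.starProjection with hPdef
  set S : Set ℂ := {w : ℂ | ∃ x : T.domain, ‖(x : H)‖ = 1 ∧ ‖P x‖ ≤ δ / 4 ∧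
      (inner ℂ (x : H) (T x) : ℂ) = w} with hS
  have hdisj : Disjoint (Metric.ball z ε) (convexHull ℝ S) := by
    rw [Set.disjoint_left]
    intro w hw1 hw2
    obtain ⟨v, hv1, hv2, rfl⟩ := aux_hull T P hw2
    have := h v hv1 (by linarith)
    rw [Metric.mem_ball] at hw1
    linarith
  obtain ⟨f, u, c, hc, hz, hu⟩ : ∃ (f : ℂ →L[ℝ] ℝ) (u : ℝ) (c : ℂ), f c = 1 ∧ f z < u ∧
      ∀ b ∈ S, u ≤ f b := by
    rcases S.eq_empty_or_nonempty with hemp | ⟨b, hb⟩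
    · exact ⟨Complex.reCLM, z.re + 1, 1, by simp, by simp, by simp [hemp]⟩
    · obtain ⟨f, u, h1, h2⟩ := geometric_hahn_banach_open (convex_ball z ε) Metric.isOpen_ball
        (convex_convexHull ℝ S) hdisj
      have hz := h1 z (Metric.mem_ball_self hε)
      have hb' := h2 b (subset_convexHull ℝ S hb)
      have hpos : 0 < f (b - z) := by rw [map_sub]; linarith
      refine ⟨f, u, (f (b - z))⁻¹ • (b - z), ?_, hz, fun b hb => h2 b (subset_convexHull ℝ S hb)⟩
      rw [map_smul, smul_eq_mul, inv_mul_cancel₀ hpos.ne']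
  have hrange : ∀ x, P x ∈ V := fun x => by
    rw [hPdef]; exact Submodule.starProjection_apply_mem V x
  have hPfin : FiniteDimensional ℂ (LinearMap.range (P : H →ₗ[ℂ] H)) :=
    Submodule.finiteDimensional_of_le (S₂ := V) (by rintro _ ⟨x, rfl⟩; exact hrange x)
  have hcone : ∀ x : T.domain, ‖(x : H)‖ = 1 → ‖P x‖ ≤ δ / 4 →
      u ≤ f (inner ℂ (x : H) (T x)) := fun x h1 h2 => hu _ ⟨x, h1, h2, rfl⟩
  obtain ⟨M, hM⟩ := aux_bounded_below T P hPfin (fun x => V.norm_starProjection_apply_le x)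
    (by positivity : 0 < δ / 4) f u hcone
  set C : ℝ := |u + M| / (δ / 4) ^ 2 with hC
  have hC0 : 0 ≤ C := by positivity
  have hCδ : C * (δ / 4) ^ 2 = |u + M| := by rw [hC]; field_simp
  intro hmem
  simp only [We2, Set.mem_iInter] at hmem
  have hKfin : FiniteDimensional ℂ
      (LinearMap.range (((C • c : ℂ) • P : H →L[ℂ] H) : H →ₗ[ℂ] H)) :=
    Submodule.finiteDimensional_of_le (S₂ := V)
      (by rintro _ ⟨x, rfl⟩; exact V.smul_mem _ (hrange x))
  have hcl := hmem ((C • c : ℂ) • P) hKfin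
  have hclosed : IsClosed {w : ℂ | u ≤ f w} := isClosed_le continuous_const f.continuous
  have hsub : numRange (pmapAddCLM T ((C • c : ℂ) • P)) ⊆ {w : ℂ | u ≤ f w} := by
    rintro w ⟨x, hx, rfl⟩
    change u ≤ f (inner ℂ (x : H) (T x + (C • c : ℂ) • P x))
    have hPx : (inner ℂ (x : H) (P x) : ℂ) = ((‖P x‖ ^ 2 : ℝ) : ℂ) := by
      have h1 : P (P x) = P x := by
        rw [hPdef]; exact Submodule.starProjection_eq_self_iff.2 (hrange x)
      have h2 : (inner ℂ (P x) (P x) : ℂ) = inner ℂ (x : H) (P (P x)) := by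
        rw [hPdef]; exact V.inner_starProjection_left_eq_right _ _
      rw [h1, inner_self_eq_norm_sq_to_K] at h2
      rw [← h2]; simp
    have e : (inner ℂ (x : H) (T x + (C • c : ℂ) • P x) : ℂ)
        = inner ℂ (x : H) (T x) + (C * ‖P x‖ ^ 2 : ℝ) • c := by
      rw [inner_add_right, inner_smul_right, hPx, Complex.real_smul, Complex.real_smul]
      push_cast; ring
    rw [e, map_add, map_smul, hc, smul_eq_mul, mul_one]
    by_cases hs : ‖P x‖ ≤ δ / 4
    · have := hcone x hx hs
      have : 0 ≤ C * ‖P x‖ ^ 2 := by positivity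
      linarith
    · have h1 := hM x hx
      have h2 : (δ / 4) ^ 2 ≤ ‖P x‖ ^ 2 :=
        pow_le_pow_left₀ (by positivity) (not_le.1 hs).le 2
      have h3 := mul_le_mul_of_nonneg_left h2 hC0
      have h4 := le_abs_self (u + M)
      linarith
  have := (hclosed.closure_subset_iff.2 hsub) hcl
  exact absurd hz (not_lt.2 this)

lemma aux_We2_sub_ess [TopologicalSpace.SeparableSpace H] (T : H →ₗ.[ℂ] H) :
    We2 T ⊆ essNumRange T := by
  intro z hz
  let d : ℕ → H := TopologicalSpace.denseSeq H
  let V : ℕ → Submodule ℂ H := fun n => Submodule.span ℂ (d '' Set.Iio n)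
  have hV : ∀ n, FiniteDimensional ℂ (V n) := fun n =>
    FiniteDimensional.span_of_finite ℂ ((Set.finite_Iio n).image d)
  have key : ∀ n : ℕ, ∃ x : T.domain, ‖(x : H)‖ = 1 ∧
      ‖(V n).starProjection x‖ ≤ 1 / ((n : ℝ) + 1) ∧
      dist (inner ℂ (x : H) (T x) : ℂ) z < 1 / ((n : ℝ) + 1) := by
    intro n
    by_contra hcon
    push Not at hcon
    have hpos : (0 : ℝ) < 1 / ((n : ℝ) + 1) := by positivity
    exact aux_exclude T (V n) hpos hpos z hcon hz
  choose x hx1 hx2 hx3 using key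
  have hlim := tendsto_one_div_add_atTop_nhds_zero_nat (𝕜 := ℝ)
  refine ⟨x, hx1, fun y => ?_, ?_⟩
  · rw [Metric.tendsto_atTop]
    intro ε hε
    obtain ⟨k, hk⟩ := (TopologicalSpace.denseRange_denseSeq H).exists_dist_lt y (half_pos hε)
    have hk' : ‖y - d k‖ < ε / 2 := by rw [← dist_eq_norm]; exact hk
    have h2 : Tendsto (fun n : ℕ => 1 / ((n : ℝ) + 1) * ‖d k‖) atTop (𝓝 0) := by
      simpa using hlim.mul_const ‖d k‖
    obtain ⟨N, hN⟩ := (Metric.tendsto_atTop.1 h2) (ε / 2) (half_pos hε)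
    refine ⟨max N (k + 1), fun n hn => ?_⟩
    have hnN := hN n ((le_max_left _ _).trans hn)
    have hnk : k < n := (le_max_right N (k + 1)).trans hn
    have hdk : d k ∈ V n := Submodule.subset_span ⟨k, hnk, rfl⟩
    have e1 : (inner ℂ (x n : H) (d k) : ℂ) = inner ℂ ((V n).starProjection (x n)) (d k) := by
      rw [(V n).inner_starProjection_left_eq_right, Submodule.starProjection_eq_self_iff.2 hdk]
    have e2 : (inner ℂ (x n : H) y : ℂ) = inner ℂ (x n : H) (y - d k)
        + inner ℂ ((V n).starProjection (x n)) (d k) := by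
      rw [← e1, ← inner_add_right, sub_add_cancel]
    rw [dist_zero_right, e2]
    have b1 : ‖(inner ℂ (x n : H) (y - d k) : ℂ)‖ ≤ ‖y - d k‖ := by
      simpa only [hx1, one_mul] using norm_inner_le_norm (𝕜 := ℂ) (x n : H) (y - d k)
    have b2 : ‖(inner ℂ ((V n).starProjection (x n)) (d k) : ℂ)‖
        ≤ 1 / ((n : ℝ) + 1) * ‖d k‖ :=
      (norm_inner_le_norm _ _).trans (mul_le_mul_of_nonneg_right (hx2 n) (norm_nonneg _))
    rw [Real.dist_eq, sub_zero] at hnN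
    have b3 := (le_abs_self _).trans_lt hnN
    have b4 := norm_add_le (inner ℂ (x n : H) (y - d k) : ℂ)
      (inner ℂ ((V n).starProjection (x n)) (d k) : ℂ)
    linarith
  · rw [tendsto_iff_dist_tendsto_zero]
    exact squeeze_zero (fun _ => dist_nonneg) (fun n => (hx3 n).le) hlim

/-- Theorem 3.1, inclusions (3.1): `W_{e1}(T) ⊆ W_{e4}(T) ⊆ W_{e2}(T) = W_{e3}(T) = W_e(T)`. -/
theorem We1_subset_We4_subset_We2_eq_We3_eq_essNumRange
    [TopologicalSpace.SeparableSpace H] (hinf : ¬FiniteDimensional ℂ H)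
    (T : H →ₗ.[ℂ] H) :
    We1 T ⊆ We4 T ∧ We4 T ⊆ We2 T ∧ We2 T = We3 T ∧ We3 T = essNumRange T := by
  have h23 := aux_We3_sub_We2 T
  have h2e := aux_We2_sub_ess T
  have he3 := aux_ess_sub_We3 T
  exact ⟨aux_We1_sub_We4 T, (aux_We4_sub_ess T).trans (he3.trans h23),
    (h2e.trans he3).antisymm h23, (h23.trans h2e).antisymm he3⟩
end
end

section
/- If T is a densely defined linear operator in H, then W_{e4}(T) = W_e(T). -/
open Filter Topology

noncomputable section

variable {H : Type*} [NormedAddCommGroup H] [InnerProductSpace ℂ H] [CompleteSpace H]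

set_option linter.unusedSectionVars false

open Asymptotics ComplexConjugate in
lemma ultra_littleO (U : Ultrafilter ℕ) (f g : ℕ → ℂ) (h : ¬ f =O[(U : Filter ℕ)] g) :
    g =o[(U : Filter ℕ)] f := by
  rw [isLittleO_iff]
  intro c hc
  have h1 : ¬ ∀ᶠ n in (U : Filter ℕ), ‖f n‖ ≤ c⁻¹ * ‖g n‖ := fun h2 => h (IsBigO.of_bound _ h2)
  rw [← Ultrafilter.eventually_not] at h1
  filter_upwards [h1] with n hn
  push Not at hn
  have := mul_lt_mul_of_pos_left hn hc
  rw [← mul_assoc, mul_inv_cancel₀ hc.ne', one_mul] at this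
  exact this.le

open Asymptotics ComplexConjugate in
lemma dich {D : Type*} [NormedAddCommGroup D] [InnerProductSpace ℂ D] (U : Ultrafilter ℕ)
    (a : D → ℕ → ℂ) (hadd : ∀ u v n, a (u + v) n = a u n + a v n)
    (hsmul : ∀ (c : ℂ) u n, a (c • u) n = conj c * a u n) (g h : D) (σ : ℂ) (hσ : σ ≠ 0)
    (hh : h ≠ 0) (hind : ∀ c : ℂ, g ≠ c • h) :
    ∃ k, (k = h ∨ k = h + σ • g) ∧ ∃ c : ℂ, inner ℂ k (g - c • k) = 0 ∧
      a k =O[(U : Filter ℕ)] a (g - c • k) := by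
  have hsub : ∀ u (c : ℂ) v n, a (u - c • v) n = a u n - conj c * a v n := by
    intro u c v n
    rw [sub_eq_add_neg, ← neg_smul, hadd, hsmul]; simp; ring
  have orth : ∀ k : D, k ≠ 0 → ∃ c : ℂ, inner ℂ k (g - c • k) = 0 := by
    intro k hk
    refine ⟨inner ℂ k g / inner ℂ k k, ?_⟩
    have : inner ℂ k k ≠ (0:ℂ) := inner_self_ne_zero.2 hk
    rw [inner_sub_right, inner_smul_right, div_mul_cancel₀ _ this, sub_self]
  have hh' : h + σ • g ≠ 0 := by
    intro h0
    apply hind (-σ⁻¹)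
    have : σ • g = - h := by rw [eq_neg_iff_add_eq_zero, add_comm]; exact h0
    rw [neg_smul, ← smul_neg, ← this, smul_smul, inv_mul_cancel₀ hσ, one_smul]
  obtain ⟨c, hc⟩ := orth h hh
  obtain ⟨c', hc'⟩ := orth _ hh'
  by_contra! H
  have b1 := H h (Or.inl rfl) c hc
  have b2 := H _ (Or.inr rfl) c' hc'
  have o1 := ultra_littleO U _ _ b1
  have o2 := ultra_littleO U _ _ b2
  have og : a g =O[(U : Filter ℕ)] a h := by
    have : a g = fun n => a (g - c • h) n + conj c * a h n := by
      funext n; rw [hsub]; ring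
    rw [this]
    exact o1.isBigO.add ((isBigO_refl _ _).const_mul_left _)
  have oh' : a (h + σ • g) =O[(U : Filter ℕ)] a h := by
    have : a (h + σ • g) = fun n => a h n + conj σ * a g n := by
      funext n; rw [hadd, hsmul]
    rw [this]
    exact (isBigO_refl _ _).add (og.const_mul_left _)
  have o3 := o2.trans_isBigO oh'
  have o4 := o3.sub (o1.const_mul_left (1 - conj c' * conj σ))
  have key : c' = c * (1 - c' * σ) := by
    by_contra hne
    have hκ : conj (c * (1 - c' * σ) - c') ≠ 0 := by
      rw [Ne, map_eq_zero, sub_eq_zero]; exact fun h => hne h.symm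
    have e : (fun n => a (g - c' • (h + σ • g)) n - (1 - conj c' * conj σ) * a (g - c • h) n)
        = fun n => conj (c * (1 - c' * σ) - c') * a h n := by
      funext n
      simp only [hsub, hadd, hsmul, map_sub, map_mul, map_one]; ring
    rw [e, isLittleO_const_mul_left_iff hκ] at o4
    apply b1
    have := isLittleO_irrefl' (f' := a h) (l := (U : Filter ℕ))
    have hz : ∀ᶠ n in (U : Filter ℕ), a h n = 0 := by
      have := isLittleO_iff.1 o4 (c := 1/2) (by norm_num)
      filter_upwards [this] with n hn
      have := norm_nonneg (a h n)
      exact norm_eq_zero.1 (by linarith)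
    refine IsBigO.of_bound 0 ?_
    filter_upwards [hz] with n hn
    simp [hn]
  have hv : g - c' • (h + σ • g) = (1 - c' * σ) • (g - c • h) := by
    have : c' • h = (c * (1 - c' * σ)) • h := by rw [← key]
    rw [smul_add, this]; module
  by_cases h1 : 1 - c' * σ = 0
  · rw [h1, mul_zero] at key
    rw [key] at h1; simp at h1
  · rw [hv, inner_smul_right, mul_eq_zero, or_iff_right h1, inner_add_left, hc, zero_add,
      inner_smul_left, mul_eq_zero, or_iff_right (by simpa using hσ)] at hc'
    have : inner ℂ (g - c • h) (g - c • h) = (0:ℂ) := by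
      rw [inner_sub_left, hc', inner_smul_left, hc]; simp
    rw [inner_self_eq_zero, sub_eq_zero] at this
    exact hind c this

lemma build (T : H →ₗ.[ℂ] H) (z : ℂ) (J : Finset T.domain → Prop) (J0 : J ∅)
    (step : ∀ s, J s → ∀ ε : ℝ, 0 < ε → ∃ e : T.domain, ‖e‖ = 1 ∧ (∀ u ∈ s, inner ℂ u e = (0:ℂ)) ∧
      ‖inner ℂ (e : H) (T e) - z‖ < ε ∧ ∃ s', J s' ∧ e ∈ s' ∧ s ⊆ s') : z ∈ We4 T := by
  have step' : ∀ (n : ℕ) (s : {s // J s}), ∃ e : T.domain, ∃ s' : {s // J s},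
      ‖e‖ = 1 ∧ (∀ u ∈ s.1, inner ℂ u e = (0:ℂ)) ∧
      ‖inner ℂ (e : H) (T e) - z‖ < 1 / ((n : ℝ) + 1) ∧ e ∈ s'.1 ∧ s.1 ⊆ s'.1 := by
    rintro n ⟨s, hs⟩
    obtain ⟨e, h1, h2, h3, s', h4, h5, h6⟩ := step s hs (1 / ((n : ℝ) + 1)) (by positivity)
    exact ⟨e, ⟨s', h4⟩, h1, h2, h3, h5, h6⟩
  choose f nx h1 h2 h3 h4 h5 using step'
  let S : ℕ → {s // J s} := fun n => Nat.rec ⟨∅, J0⟩ (fun n s => nx n s) n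
  have hS : ∀ n, S (n+1) = nx n (S n) := fun n => rfl
  have mono : Monotone (fun n => (S n).1) := monotone_nat_of_le_succ (fun n => by
    rw [hS]; exact h5 n (S n))
  have horth : ∀ m n, m < n → inner ℂ (f m (S m)) (f n (S n)) = (0:ℂ) := by
    intro m n hmn
    apply h2
    apply mono (Nat.succ_le_of_lt hmn)
    show _ ∈ (S (m+1)).1
    rw [hS]; exact h4 _ _
  refine ⟨fun n => f n (S n), ⟨fun n => h1 _ _, ?_⟩, ?_⟩
  · intro m n hmn
    rcases lt_or_gt_of_ne hmn with h | h
    · exact horth m n h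
    · exact inner_eq_zero_symm.1 (horth n m h)
  · rw [tendsto_iff_norm_sub_tendsto_zero]
    exact squeeze_zero (fun _ => norm_nonneg _) (fun n => (h3 n (S n)).le)
      tendsto_one_div_add_atTop_nhds_zero_nat

/-- Pairwise orthonormality of a finite set. -/
def ONs {D : Type*} [NormedAddCommGroup D] [InnerProductSpace ℂ D] (s : Finset D) : Prop :=
  (∀ u ∈ s, ‖u‖ = 1) ∧ ∀ u ∈ s, ∀ v ∈ s, u ≠ v → inner ℂ u v = (0:ℂ)

lemma ONs_insert {D : Type*} [NormedAddCommGroup D] [InnerProductSpace ℂ D] [DecidableEq D]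
    {s : Finset D} (hs : ONs s) {e : D} (he : ‖e‖ = 1) (h : ∀ u ∈ s, inner ℂ u e = (0:ℂ)) :
    ONs (insert e s) := by
  refine ⟨?_, ?_⟩
  · intro u hu
    rcases Finset.mem_insert.1 hu with rfl | hu
    · exact he
    · exact hs.1 u hu
  · intro u hu v hv huv
    rcases Finset.mem_insert.1 hu with hu' | hu' <;> rcases Finset.mem_insert.1 hv with hv' | hv'
    · exact absurd (hu'.trans hv'.symm) huv
    · rw [hu']; exact inner_eq_zero_symm.1 (h v hv')
    · rw [hv']; exact h u hu'
    · exact hs.2 u hu' v hv' huv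

/-- Projection onto the span of a finite orthonormal set. -/
def pr {D : Type*} [NormedAddCommGroup D] [InnerProductSpace ℂ D] (s : Finset D) (x : D) : D :=
  ∑ u ∈ s, (inner ℂ u x : ℂ) • u

lemma pr_orth {D : Type*} [NormedAddCommGroup D] [InnerProductSpace ℂ D] {s : Finset D}
    (hs : ONs s) (x : D) : ∀ u ∈ s, inner ℂ u (x - pr s x) = (0:ℂ) := by
  intro u hu
  rw [inner_sub_right, pr, inner_sum, Finset.sum_eq_single u]
  · rw [inner_smul_right, inner_self_eq_norm_sq_to_K, hs.1 u hu]; simp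
  · intro v hv hvu
    rw [inner_smul_right, hs.2 u hu v hv hvu.symm, mul_zero]
  · exact fun h => absurd hu h

open ComplexConjugate in
lemma pr_facts (T : H →ₗ.[ℂ] H) (l : Filter ℕ) (x : ℕ → T.domain) (hx : ∀ n, ‖x n‖ = 1)
    (hw : ∀ y : H, Tendsto (fun n => (inner ℂ (x n : H) y : ℂ)) l (𝓝 0)) (s : Finset T.domain) :
    Tendsto (fun n => ‖x n - pr s (x n)‖) l (𝓝 1) ∧
    (∀ y : H, Tendsto (fun n => (inner ℂ ((x n - pr s (x n) : T.domain) : H) y : ℂ)) l (𝓝 0)) ∧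
    (∀ y : H, Tendsto (fun n => (inner ℂ y (T (x n - pr s (x n))) : ℂ) - inner ℂ y (T (x n)))
      l (𝓝 0)) ∧
    Tendsto (fun n => (inner ℂ ((x n - pr s (x n) : T.domain) : H) (T (x n - pr s (x n))) : ℂ)
      - inner ℂ (x n : H) (T (x n))
      + ∑ u ∈ s, (inner ℂ (x n : H) (u : H) : ℂ) * inner ℂ (u : H) (T (x n))) l (𝓝 0) := by
  have hw' : ∀ y : H, Tendsto (fun n => (inner ℂ y (x n : H) : ℂ)) l (𝓝 0) := by
    intro y
    have := (Complex.continuous_conj.tendsto 0).comp (hw y)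
    simpa [Function.comp_def, inner_conj_symm] using this
  have hp : Tendsto (fun n => pr s (x n)) l (𝓝 0) := by
    have : Tendsto (fun n => pr s (x n)) l (𝓝 (∑ u ∈ s, (0:ℂ) • u)) :=
      tendsto_finsetSum _ (fun u _ => (hw' u).smul_const u)
    simpa using this
  have hpH : Tendsto (fun n => ((pr s (x n) : T.domain) : H)) l (𝓝 0) := by
    exact (continuous_subtype_val.tendsto (0 : T.domain)).comp hp
  have hTp : Tendsto (fun n => T (pr s (x n))) l (𝓝 0) := by
    have : Tendsto (fun n => ∑ u ∈ s, (inner ℂ (u : H) (x n : H) : ℂ) • T u) l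
        (𝓝 (∑ u ∈ s, (0:ℂ) • T u)) :=
      tendsto_finsetSum _ (fun u _ => (hw' u).smul_const (T u))
    have e : ∀ n, T (pr s (x n)) = ∑ u ∈ s, (inner ℂ (u : H) (x n : H) : ℂ) • T u := by
      intro n
      show T.toFun _ = _
      rw [pr, map_sum]
      simp only [map_smul]
      rfl
    simpa [e] using this
  refine ⟨?_, ?_, ?_, ?_⟩
  · have h0 : Tendsto (fun n => ‖pr s (x n)‖) l (𝓝 0) := by simpa using hp.norm
    rw [tendsto_iff_norm_sub_tendsto_zero]
    refine squeeze_zero (fun _ => norm_nonneg _) (fun n => ?_) h0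
    have := abs_norm_sub_norm_le (x n - pr s (x n)) (x n)
    rw [hx n] at this
    simpa using this
  · intro y
    have := (hw y).sub (hpH.inner (𝕜 := ℂ) (tendsto_const_nhds (x := y)))
    simpa [inner_sub_left] using this
  · intro y
    have := ((tendsto_const_nhds (x := y)).inner (𝕜 := ℂ) hTp).neg
    simpa [LinearPMap.map_sub, inner_sub_right] using this
  · have h1 : Tendsto (fun n => (inner ℂ (x n : H) (T (pr s (x n))) : ℂ)) l (𝓝 0) := by
      rw [tendsto_zero_iff_norm_tendsto_zero]
      have h0 : Tendsto (fun n => ‖T (pr s (x n))‖) l (𝓝 0) := by simpa using hTp.norm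
      refine squeeze_zero (fun _ => norm_nonneg _) (fun n => ?_) h0
      have := norm_inner_le_norm (𝕜 := ℂ) (x n : H) (T (pr s (x n)))
      have h2 : ‖(x n : H)‖ = 1 := hx n
      rwa [h2, one_mul] at this
    have h2 := hpH.inner (𝕜 := ℂ) hTp
    have h3 := h2.sub h1
    rw [inner_zero_left, sub_zero] at h3
    refine h3.congr (fun n => ?_)
    have e : (inner ℂ ((pr s (x n) : T.domain) : H) (T (x n)) : ℂ)
        = ∑ u ∈ s, (inner ℂ (x n : H) (u : H) : ℂ) * inner ℂ (u : H) (T (x n)) := by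
      have : ((pr s (x n) : T.domain) : H) = ∑ u ∈ s, (inner ℂ (u : H) (x n : H) : ℂ) • (u : H) := by
        simp [pr]
      rw [this, sum_inner]
      refine Finset.sum_congr rfl (fun u _ => ?_)
      rw [inner_smul_left, inner_conj_symm]
    rw [← e, LinearPMap.map_sub, Submodule.coe_sub, inner_sub_left, inner_sub_right,
      inner_sub_right]
    ring

/-- Normalising a vector. -/
lemma normalise (T : H →ₗ.[ℂ] H) (h : T.domain) (hh : h ≠ 0) :
    ∃ c : ℂ, c ≠ 0 ∧ ‖c • h‖ = 1 ∧
      (inner ℂ ((c • h : T.domain) : H) (T (c • h)) : ℂ)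
        = inner ℂ (h : H) (T h) / ((‖h‖ ^ 2 : ℝ) : ℂ) := by
  have hn : ‖h‖ ≠ 0 := norm_ne_zero_iff.2 hh
  refine ⟨((‖h‖⁻¹ : ℝ) : ℂ), by simpa using hh, ?_, ?_⟩
  · rw [norm_smul, Complex.norm_real, norm_inv, norm_norm, inv_mul_cancel₀ hn]
  · rw [LinearPMap.map_smul, Submodule.coe_smul, inner_smul_left, inner_smul_right,
      Complex.conj_ofReal]
    push_cast
    have : (‖h‖ : ℂ) ≠ 0 := by exact_mod_cast hn
    field_simp

lemma quot_lim (T : H →ₗ.[ℂ] H) (l : Filter ℕ) (h : ℕ → T.domain) (μ : ℂ)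
    (hq : Tendsto (fun n => (inner ℂ (h n : H) (T (h n)) : ℂ)) l (𝓝 μ))
    (hn : Tendsto (fun n => ‖h n‖) l (𝓝 1)) :
    Tendsto (fun n => (inner ℂ (h n : H) (T (h n)) : ℂ) / ((‖h n‖ ^ 2 : ℝ) : ℂ)) l (𝓝 μ) := by
  have := hq.div (((Complex.continuous_ofReal.tendsto _).comp (hn.pow 2))) (by simp)
  simp only [one_pow, Complex.ofReal_one, div_one] at this
  exact this

open Asymptotics ComplexConjugate in
lemma case_one (T : H →ₗ.[ℂ] H) (z : ℂ) (U : Ultrafilter ℕ) (x : ℕ → T.domain)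
    (hx : ∀ n, ‖x n‖ = 1)
    (hw : ∀ y : H, Tendsto (fun n => (inner ℂ (x n : H) y : ℂ)) U (𝓝 0))
    (hq : Tendsto (fun n => (inner ℂ (x n : H) (T (x n)) : ℂ)) U (𝓝 z))
    (hb : ∀ g : T.domain, (fun n => (inner ℂ (g : H) (T (x n)) : ℂ))
      =O[(U : Filter ℕ)] (fun _ => (1:ℂ))) : z ∈ We4 T := by
  classical
  refine build T z ONs ⟨by simp, by simp⟩ ?_
  intro s hs ε hε
  obtain ⟨f1, f2, f3, f4⟩ := pr_facts T U x hx hw s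
  have hsum : Tendsto (fun n => ∑ u ∈ s, (inner ℂ (x n : H) (u : H) : ℂ)
      * inner ℂ (u : H) (T (x n))) U (𝓝 0) := by
    have : Tendsto (fun n => ∑ u ∈ s, (inner ℂ (x n : H) (u : H) : ℂ)
      * inner ℂ (u : H) (T (x n))) U (𝓝 (∑ u ∈ s, (0:ℂ))) := by
      refine tendsto_finsetSum _ (fun u _ => ?_)
      have := ((isLittleO_one_iff ℂ).2 (hw u)).mul_isBigO (hb u)
      simpa [isLittleO_one_iff] using this
    simpa using this
  have hy := (f4.add hq).sub hsum
  simp only [zero_add, sub_zero] at hy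
  have hy2 : Tendsto (fun n => (inner ℂ ((x n - pr s (x n) : T.domain) : H)
      (T (x n - pr s (x n))) : ℂ)) U (𝓝 z) := hy.congr (fun n => by ring)
  have e1 := quot_lim T U _ z hy2 f1
  have ev1 := Metric.tendsto_nhds.1 e1 ε hε
  have ev2 := f1.eventually (lt_mem_nhds (zero_lt_one))
  obtain ⟨n, hn1, hn2⟩ := (ev1.and ev2).exists
  obtain ⟨c, hc0, hc1, hc2⟩ := normalise T (x n - pr s (x n)) (norm_pos_iff.1 hn2)
  have ho : ∀ u ∈ s, inner ℂ u (c • (x n - pr s (x n))) = (0:ℂ) := by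
    intro u hu
    rw [inner_smul_right, pr_orth hs (x n) u hu, mul_zero]
  refine ⟨c • (x n - pr s (x n)), hc1, ho, ?_, _, ONs_insert hs hc1 ho,
    Finset.mem_insert_self _ _, Finset.subset_insert _ _⟩
  rw [hc2, ← dist_eq_norm]
  exact hn1

open Asymptotics in
lemma bigO_atTop (U : Ultrafilter ℕ) (f g : ℕ → ℂ) (h : f =O[(U : Filter ℕ)] g)
    (hf : Tendsto (fun n => ‖f n‖) U atTop) : Tendsto (fun n => ‖g n‖) U atTop := by
  obtain ⟨C, hC0, hC⟩ := h.exists_pos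
  have hC := hC.bound
  have h1 : Tendsto (fun n => C⁻¹ * ‖f n‖) U atTop :=
    hf.const_mul_atTop (inv_pos.2 hC0)
  refine tendsto_atTop_mono' _ ?_ h1
  filter_upwards [hC] with m hm
  rw [inv_mul_le_iff₀ hC0]
  exact hm

open Asymptotics ComplexConjugate in
/-- Correcting the quadratic form by a small multiple of `g`. -/
lemma correct (T : H →ₗ.[ℂ] H) (U : Ultrafilter ℕ) (y : ℕ → T.domain) (g : T.domain) (μ : ℂ)
    (hn : Tendsto (fun n => ‖y n‖) U (𝓝 1))
    (hw : ∀ v : H, Tendsto (fun n => (inner ℂ (y n : H) v : ℂ)) U (𝓝 0))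
    (hb : Tendsto (fun n => ‖(inner ℂ (g : H) (T (y n)) : ℂ)‖) U atTop)
    (hq : (fun n => (inner ℂ (y n : H) (T (y n)) : ℂ))
      =o[(U : Filter ℕ)] (fun n => (inner ℂ (g : H) (T (y n)) : ℂ))) :
    let t : ℕ → ℂ := fun n => conj ((μ - inner ℂ (y n : H) (T (y n))) / inner ℂ (g : H) (T (y n)))
    Tendsto (fun n => ‖y n + t n • g‖) U (𝓝 1) ∧
    Tendsto (fun n => (inner ℂ (y n + t n • g) g : ℂ)) U (𝓝 0) ∧
    Tendsto (fun n => (inner ℂ ((y n + t n • g : T.domain) : H) (T (y n + t n • g)) : ℂ)) U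
      (𝓝 μ) := by
  intro t
  have ht : Tendsto t U (𝓝 0) := by
    have h1 : (fun n => μ - (inner ℂ (y n : H) (T (y n)) : ℂ))
      =o[(U : Filter ℕ)] (fun n => (inner ℂ (g : H) (T (y n)) : ℂ)) := by
      refine IsLittleO.sub ?_ hq
      rw [isLittleO_const_left]
      exact Or.inr hb
    have h2 := (Complex.continuous_conj.tendsto 0).comp h1.tendsto_div_nhds_zero
    simpa [Function.comp_def, t] using h2
  have htg : Tendsto (fun n => t n • g) U (𝓝 0) := by
    simpa using ht.smul_const g
  refine ⟨?_, ?_, ?_⟩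
  · have h0 : Tendsto (fun n => ‖t n • g‖) U (𝓝 0) := by simpa using htg.norm
    have h1 : Tendsto (fun n => ‖y n + t n • g‖ - ‖y n‖) U (𝓝 0) := by
      rw [tendsto_zero_iff_norm_tendsto_zero]
      refine squeeze_zero (fun _ => norm_nonneg _) (fun n => ?_) h0
      have := abs_norm_sub_norm_le (y n + t n • g) (y n)
      simpa using this
    simpa using h1.add hn
  · have h1 : Tendsto (fun n => (inner ℂ (y n) g : ℂ)) U (𝓝 0) := hw g
    have := h1.add (htg.inner (𝕜 := ℂ) (tendsto_const_nhds (x := g)))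
    rw [inner_zero_left, add_zero] at this
    exact this.congr (fun n => (inner_add_left _ _ _).symm)
  · have h1 := (ht.mul (hw (T g)))
    have h2 := (((Complex.continuous_conj.tendsto 0).comp ht).mul ht).mul_const
      (inner ℂ (g : H) (T g))
    have h3 := (h1.add h2).const_add μ
    simp only [map_zero, mul_zero, zero_mul, add_zero] at h3
    refine h3.congr' ?_
    filter_upwards [hb.eventually_gt_atTop 0] with n hn0
    have hne : (inner ℂ (g : H) (T (y n)) : ℂ) ≠ 0 := norm_pos_iff.1 hn0
    have hct : conj (t n) * (inner ℂ (g : H) (T (y n)) : ℂ)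
        = μ - inner ℂ (y n : H) (T (y n)) := by
      simp only [t, Complex.conj_conj]
      exact div_mul_cancel₀ _ hne
    rw [LinearPMap.map_add, LinearPMap.map_smul, Submodule.coe_add, Submodule.coe_smul,
      inner_add_left, inner_add_right, inner_add_right, inner_smul_left, inner_smul_left,
      inner_smul_right, inner_smul_right, hct]
    simp only [Function.comp_apply]
    ring

open Asymptotics ComplexConjugate in
lemma case_two (T : H →ₗ.[ℂ] H) (z : ℂ) (U : Ultrafilter ℕ) (x : ℕ → T.domain)
    (hx : ∀ n, ‖x n‖ = 1)
    (hw : ∀ y : H, Tendsto (fun n => (inner ℂ (x n : H) y : ℂ)) U (𝓝 0))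
    (hq : Tendsto (fun n => (inner ℂ (x n : H) (T (x n)) : ℂ)) U (𝓝 z))
    (g₀ : T.domain)
    (hg₀ : Tendsto (fun n => ‖(inner ℂ (g₀ : H) (T (x n)) : ℂ)‖) U atTop) : z ∈ We4 T := by
  classical
  let a : T.domain → ℕ → ℂ := fun g n => inner ℂ (g : H) (T (x n))
  have hadd : ∀ u v n, a (u + v) n = a u n + a v n := fun u v n => by
    simp [a, inner_add_left]
  have hsmul : ∀ (c : ℂ) u n, a (c • u) n = conj c * a u n := fun c u n => by
    simp [a, inner_smul_left, mul_comm]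
  refine build T z (fun s => ONs s ∧ ∃ g : T.domain, (∀ u ∈ s, inner ℂ u g = (0:ℂ)) ∧
    Tendsto (fun n => ‖a g n‖) U atTop ∧ ∀ u ∈ s, a u =O[(U : Filter ℕ)] a g)
    ⟨⟨by simp, by simp⟩, g₀, by simp, hg₀, by simp⟩ ?_
  rintro s ⟨hs, g, hgs, hga, hdom⟩ ε hε
  obtain ⟨f1, f2, f3, f4⟩ := pr_facts T U x hx hw s
  have hone : ∀ c : ℂ, (fun _ => c) =o[(U : Filter ℕ)] a g := fun c => by
    rw [isLittleO_const_left]; exact Or.inr hga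
  have small : ∀ (f : ℕ → ℂ) (c : ℂ), Tendsto f U (𝓝 c) → f =o[(U : Filter ℕ)] a g :=
    fun f c hf => (hf.isBigO_one ℂ).trans_isLittleO (hone 1)
  -- the corrected pairing with g
  have hbe : (fun n => (inner ℂ (g : H) (T (x n - pr s (x n))) : ℂ)) ~[(U : Filter ℕ)] a g :=
    small _ 0 (f3 g)
  have hb : Tendsto (fun n => ‖(inner ℂ (g : H) (T (x n - pr s (x n))) : ℂ)‖) U atTop :=
    bigO_atTop U _ _ hbe.symm.isBigO hga
  have hqy : (fun n => (inner ℂ ((x n - pr s (x n) : T.domain) : H) (T (x n - pr s (x n))) : ℂ))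
      =o[(U : Filter ℕ)] a g := by
    have hsum : (fun n => ∑ u ∈ s, (inner ℂ (x n : H) (u : H) : ℂ)
      * inner ℂ (u : H) (T (x n))) =o[(U : Filter ℕ)] a g := by
      refine IsLittleO.fun_sum (fun u hu => ?_)
      have := ((isLittleO_one_iff ℂ).2 (hw u)).mul_isBigO (hdom u hu)
      simpa using this
    have := ((small _ _ f4).add (small _ _ hq)).sub hsum
    refine this.congr_left (fun n => by ring)
  have hqb := hqy.trans_isBigO hbe.symm.isBigO
  obtain ⟨A1, A2, A3⟩ := correct T U (fun n => x n - pr s (x n)) g z f1 f2 hb hqb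
  obtain ⟨B1, B2, B3⟩ := correct T U (fun n => x n - pr s (x n)) g (z + (ε/2 : ℝ)) f1 f2 hb hqb
  have evA := Metric.tendsto_nhds.1 (quot_lim T U _ _ A3 A1) ε hε
  have evB := Metric.tendsto_nhds.1 (quot_lim T U _ _ B3 B1) (ε/2) (half_pos hε)
  have hg0 : g ≠ 0 := by
    rintro rfl
    have : (fun n => ‖a 0 n‖) = fun _ => (0:ℝ) := by funext n; simp [a]
    rw [this] at hga
    obtain ⟨n, hn⟩ := (hga.eventually_gt_atTop 0).exists
    exact lt_irrefl _ hn
  have evI := (A2.norm.sub (A1.mul_const ‖g‖)).eventually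
    (gt_mem_nhds (show ‖(0:ℂ)‖ - 1 * ‖g‖ < 0 by simpa using hg0))
  have evN := A1.eventually (lt_mem_nhds (zero_lt_one))
  have evM := B1.eventually (lt_mem_nhds (zero_lt_one))
  obtain ⟨n, hA, hB, hI, hN, hM, hb0⟩ := (evA.and (evB.and (evI.and (evN.and (evM.and
    (hb.eventually_gt_atTop 0)))))).exists
  have hpo := pr_orth hs (x n)
  set y := x n - pr s (x n) with hy
  set t := conj ((z - inner ℂ (y : H) (T y)) / inner ℂ (g : H) (T y)) with ht
  set t' := conj ((z + (ε/2 : ℝ) - inner ℂ (y : H) (T y)) / inner ℂ (g : H) (T y)) with ht'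
  have hbne : (inner ℂ (g : H) (T y) : ℂ) ≠ 0 := norm_pos_iff.1 hb0
  have hσ : t' - t ≠ 0 := by
    rw [ht, ht', ← map_sub, ← sub_div, Ne, map_eq_zero, div_eq_zero_iff, not_or]
    refine ⟨?_, hbne⟩
    ring_nf
    simpa using hε.ne'
  have hh : y + t • g ≠ 0 := norm_pos_iff.1 hN
  have hind : ∀ c : ℂ, g ≠ c • (y + t • g) := by
    intro c hc
    have h1 : ‖(inner ℂ (y + t • g) g : ℂ)‖ = ‖y + t • g‖ * ‖g‖ := by
      generalize y + t • g = h at hc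
      subst hc
      rw [inner_smul_right, inner_self_eq_norm_sq_to_K, norm_mul, norm_smul]
      simp; ring
    linarith
  obtain ⟨k, hk, c, hc1, hc2⟩ := dich U a hadd hsmul g (y + t • g) (t' - t) hσ hh hind
  have hh' : y + t • g + (t' - t) • g = y + t' • g := by module
  have hks : ∀ u ∈ s, inner ℂ u k = (0:ℂ) := by
    intro u hu
    rcases hk with rfl | rfl <;>
    simp [inner_add_right, inner_smul_right, hpo u hu, hgs u hu]
  have hk0 : k ≠ 0 ∧
      dist ((inner ℂ (k : H) (T k) : ℂ) / ((‖k‖ ^ 2 : ℝ) : ℂ)) z < ε := by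
    rcases hk with rfl | rfl
    · exact ⟨hh, hA⟩
    · rw [hh']
      refine ⟨norm_pos_iff.1 hM, ?_⟩
      refine (dist_triangle _ (z + (ε/2 : ℝ)) _).trans_lt ?_
      have : dist (z + ((ε/2 : ℝ) : ℂ)) z = ε/2 := by
        rw [dist_eq_norm, add_sub_cancel_left, Complex.norm_real, Real.norm_of_nonneg (by linarith)]
      rw [this]
      linarith
  obtain ⟨hk0, hkd⟩ := hk0
  obtain ⟨d, hd0, hd1, hd2⟩ := normalise T k hk0
  have ho : ∀ u ∈ s, inner ℂ u (d • k) = (0:ℂ) := fun u hu => by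
    rw [inner_smul_right, hks u hu, mul_zero]
  have hgv : a g =O[(U : Filter ℕ)] a (g - c • k) := by
    have : a g = fun n => a (g - c • k) n + conj c * a k n := by
      funext n; rw [← hsmul, ← hadd, sub_add_cancel]
    rw [this]
    exact (isBigO_refl _ _).add (hc2.const_mul_left _)
  refine ⟨d • k, hd1, ho, ?_, insert (d • k) s, ⟨ONs_insert hs hd1 ho, g - c • k, ?_, ?_, ?_⟩,
    Finset.mem_insert_self _ _, Finset.subset_insert _ _⟩
  · rw [hd2, ← dist_eq_norm]
    exact hkd
  · intro u hu
    rcases Finset.mem_insert.1 hu with rfl | hu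
    · rw [inner_smul_left, hc1, mul_zero]
    · rw [inner_sub_right, inner_smul_right, hgs u hu, hks u hu]; simp
  · exact bigO_atTop U _ _ hgv hga
  · intro u hu
    rcases Finset.mem_insert.1 hu with rfl | hu
    · have : a (d • k) = fun n => conj d * a k n := by funext n; rw [hsmul]
      rw [this]
      exact hc2.const_mul_left _
    · exact (hdom u hu).trans hgv

/-- Theorem 3.1, (3.2): if `T` is densely defined, then `W_{e4}(T) = W_e(T)`. -/
theorem We4_eq_essNumRange_of_dense
    [TopologicalSpace.SeparableSpace H] (hinf : ¬FiniteDimensional ℂ H)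
    (T : H →ₗ.[ℂ] H) (hdense : Dense (T.domain : Set H)) :
    We4 T = essNumRange T := by
  apply Set.Subset.antisymm
  · rintro z ⟨e, he, hz⟩
    refine ⟨e, he.1, ?_, hz⟩
    intro y
    have h1 := (he.inner_products_summable (x := y)).tendsto_atTop_zero
    have h2 := h1.sqrt
    rw [Real.sqrt_zero] at h2
    rw [tendsto_zero_iff_norm_tendsto_zero]
    refine h2.congr (fun n => ?_)
    rw [Real.sqrt_sq (norm_nonneg _)]
  · rintro z ⟨x, hx, hw, hq⟩
    let U : Ultrafilter ℕ := hyperfilter ℕ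
    have hU : (U : Filter ℕ) ≤ atTop := Nat.hyperfilter_le_atTop
    by_cases hb : ∀ g : T.domain, Asymptotics.IsBigO (U : Filter ℕ)
        (fun n => (inner ℂ (g : H) (T (x n)) : ℂ)) (fun _ => (1:ℂ))
    · exact case_one T z U x hx (fun y => (hw y).mono_left hU) (hq.mono_left hU) hb
    · push Not at hb
      obtain ⟨g, hg⟩ := hb
      refine case_two T z U x hx (fun y => (hw y).mono_left hU) (hq.mono_left hU) g ?_
      have h1 := ultra_littleO U _ _ hg
      rw [Asymptotics.isLittleO_const_left] at h1
      simpa [Function.comp_def] using h1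
end
end
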